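/- arXiv:2401.15637 — 3 statements merged into one kernel-verified Lean document; each statement's English description precedes it below -/
import Mathlib

section
/- (Combined Pohozaev identity for problem (1.1)) Let N ≥ 3, λ > 0, μ ∈ ℝ and 2 < p < 2*. If u is a classical solution of problem (1.1) lying in X (finite weighted energy), then μ (N/p - (N-2)/2) ∫_{ℝ^N_+} |u|^p dx = (1/2) ∫_{ℝ^N_+} (x·∇u)² dx - (N(N-2)/8) ∫_{ℝ^N_+} u² dx. -/
open MeasureTheory Real Topology Filter

noncomputable section

/-- `ℝ^N` as Euclidean space. -/
abbrev Euc (N : ℕ) := EuclideanSpace ℝ (Fin N)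

/-- Gaussian-type weight `K(x) = exp(|x|²/4)`. -/
noncomputable def Kw {N : ℕ} (x : Euc N) : ℝ := Real.exp (‖x‖ ^ 2 / 4)

/-- critical Sobolev exponent `2* = 2N/(N-2)` -/
noncomputable def twoStar (N : ℕ) : ℝ := 2 * (N : ℝ) / ((N : ℝ) - 2)

/-- critical trace exponent `2_* = 2(N-1)/(N-2)` -/
noncomputable def twoStarL (N : ℕ) : ℝ := 2 * ((N : ℝ) - 1) / ((N : ℝ) - 2)

/-- `i`-th partial derivative of `u` at `x` -/
noncomputable def pd {N : ℕ} (u : Euc N → ℝ) (i : Fin N) (x : Euc N) : ℝ :=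
  fderiv ℝ u x (EuclideanSpace.single i 1)

/-- `|∇u(x)|²` -/
noncomputable def gradSq {N : ℕ} (u : Euc N → ℝ) (x : Euc N) : ℝ :=
  ∑ i, (pd u i x) ^ 2

/-- `x · ∇u(x)` -/
noncomputable def radial {N : ℕ} (u : Euc N → ℝ) (x : Euc N) : ℝ :=
  ∑ i, x i * pd u i x

/-- Laplacian `Δu(x)` -/
noncomputable def lap {N : ℕ} (u : Euc N → ℝ) (x : Euc N) : ℝ :=
  ∑ i, pd (pd u i) i x

/-- index of the vertical coordinate `x_N` -/
def lastIdx (N : ℕ) (h : 0 < N) : Fin N := ⟨N - 1, by omega⟩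

/-- open upper half-space `ℝ^N_+` -/
def upperHS (N : ℕ) (h : 0 < N) : Set (Euc N) := {x | 0 < x (lastIdx N h)}

/-- closed upper half-space -/
def upperHSc (N : ℕ) (h : 0 < N) : Set (Euc N) := {x | 0 ≤ x (lastIdx N h)}

/-- boundary hyperplane `∂ℝ^N_+` -/
def bdryHS (N : ℕ) (h : 0 < N) : Set (Euc N) := {x | x (lastIdx N h) = 0}

/-- vertical derivative `∂u/∂x_N`, taken within the closed half-space -/
noncomputable def pdN (N : ℕ) (h : 0 < N) (u : Euc N → ℝ) (x : Euc N) : ℝ :=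
  fderivWithin ℝ u (upperHSc N h) x (EuclideanSpace.single (lastIdx N h) 1)

/-- embedding of `ℝ^{N-1}` as the boundary of the half-space, `y ↦ (y, 0)` -/
noncomputable def emb (N : ℕ) (y : Euc (N - 1)) : Euc N :=
  (EuclideanSpace.equiv (Fin N) ℝ).symm
    (fun i => if hi : (i : ℕ) < N - 1 then y ⟨(i : ℕ), hi⟩ else 0)

/-- finite weighted energy, i.e. membership in the space `X` -/
def FiniteEnergy (N : ℕ) (h : 0 < N) (u : Euc N → ℝ) : Prop :=
  IntegrableOn (fun x => Kw x * (gradSq u x + (u x) ^ 2)) (upperHS N h)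

/-- classical solution of problem (1.1) -/
structure IsClassicalSolution (N : ℕ) (h : 0 < N) (lam mu p : ℝ) (u : Euc N → ℝ) : Prop where
  smooth2 : ContDiffOn ℝ 2 u (upperHS N h)
  smooth1 : ContDiffOn ℝ 1 u (upperHSc N h)
  pde : ∀ x ∈ upperHS N h,
    -lap u x - (1 / 2) * radial u x
      = lam * |u x| ^ (twoStar N - 2) * u x + mu * |u x| ^ (p - 2) * u x
  bc : ∀ x ∈ bdryHS N h,
    -pdN N h u x = Real.sqrt lam * |u x| ^ (twoStarL N - 2) * u x

/-- `x_N⁰ = √(N/(N-2))` -/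
noncomputable def xN0 (N : ℕ) : ℝ := Real.sqrt ((N : ℝ) / ((N : ℝ) - 2))

/-- `k_N = (N(N-2))^{(N-2)/4}` -/
noncomputable def kN (N : ℕ) : ℝ := ((N : ℝ) * ((N : ℝ) - 2)) ^ (((N : ℝ) - 2) / 4)

/-- `|x'|²`, squared norm of the horizontal part -/
noncomputable def horizSq {N : ℕ} (h : 0 < N) (x : Euc N) : ℝ :=
  ∑ i ∈ Finset.univ.erase (lastIdx N h), (x i) ^ 2

/-- the family `φ_{ε,τ}` -/
noncomputable def bubbleT (N : ℕ) (h : 0 < N) (ε τ : ℝ) (x : Euc N) : ℝ :=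
  (ε * Real.sqrt ((N : ℝ) * ((N : ℝ) - 2)) /
      (ε ^ 2 + horizSq h x + (x (lastIdx N h) + ε * τ * xN0 N) ^ 2)) ^ (((N : ℝ) - 2) / 2)

/-- the boundary bubble `U_ε = φ_{ε,1}` -/
noncomputable def Ubub (N : ℕ) (h : 0 < N) (ε : ℝ) (x : Euc N) : ℝ := bubbleT N h ε 1 x

/-- `K₁ = ∫_{ℝ^N_+} |∇U_ε|²` (an `ε`-independent constant, computed at `ε = 1`) -/
noncomputable def Kone (N : ℕ) (h : 0 < N) : ℝ :=
  ∫ x in upperHS N h, gradSq (Ubub N h 1) x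

/-- `K₂ = ∫_{ℝ^N_+} U_ε^{2*}` -/
noncomputable def Ktwo (N : ℕ) (h : 0 < N) : ℝ :=
  ∫ x in upperHS N h, (Ubub N h 1 x) ^ twoStar N

/-- `K₃ = ∫_{ℝ^{N-1}} U_ε(x',0)^{2_*}` -/
noncomputable def Kthree (N : ℕ) (h : 0 < N) : ℝ :=
  ∫ y : Euc (N - 1), (Ubub N h 1 (emb N y)) ^ twoStarL N

/-- cut-off function: `φ ∈ C_c^∞(ℝ^N,[0,1])`, `φ ≡ 1` on `B₁(0)`, `φ ≡ 0` outside `B₂(0)` -/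
structure IsCutoff (N : ℕ) (φ : Euc N → ℝ) : Prop where
  smooth : ContDiff ℝ (⊤ : ℕ∞) φ
  mem01 : ∀ x, φ x ∈ Set.Icc (0 : ℝ) 1
  eq_one : ∀ x ∈ Metric.closedBall (0 : Euc N) 1, φ x = 1
  eq_zero : ∀ x ∉ Metric.ball (0 : Euc N) 2, φ x = 0

/-- truncated weighted bubble `Ũ_ε = K^{-1/2} φ U_ε` -/
noncomputable def Ut (N : ℕ) (h : 0 < N) (φ : Euc N → ℝ) (ε : ℝ) (x : Euc N) : ℝ :=
  (Kw x) ^ (-(1 : ℝ) / 2) * φ x * Ubub N h ε x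

/-- smooth compactly supported test functions on the closed half-space -/
structure IsTestFun (N : ℕ) (h : 0 < N) (u : Euc N → ℝ) : Prop where
  smooth : ContDiff ℝ (⊤ : ℕ∞) u
  cpt : HasCompactSupport u
  supp : tsupport u ⊆ upperHSc N h

/-- the norm of the space `X`: `‖u‖ = (∫ K |∇u|²)^{1/2}` -/
noncomputable def Xnorm (N : ℕ) (h : 0 < N) (u : Euc N → ℝ) : ℝ :=
  Real.sqrt (∫ x in upperHS N h, Kw x * gradSq u x)



section

open Set

lemma isOpen_upperHS (N : ℕ) (h : 0 < N) : IsOpen (upperHS N h) := by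
  have : Continuous (fun x : Euc N => x (lastIdx N h)) := by fun_prop
  exact isOpen_lt continuous_const this

lemma isClosed_upperHSc (N : ℕ) (h : 0 < N) : IsClosed (upperHSc N h) := by
  have : Continuous (fun x : Euc N => x (lastIdx N h)) := by fun_prop
  exact isClosed_le continuous_const this

lemma upperHS_subset (N : ℕ) (h : 0 < N) : upperHS N h ⊆ upperHSc N h := fun x hx => by
  simp only [upperHS, upperHSc, mem_ofPred_eq] at *; exact hx.le

lemma integrable_of_cont_cpt {N : ℕ} {U K : Set (Euc N)} (hK : IsCompact K) (hKU : K ⊆ U)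
    {f : Euc N → ℝ} (hf : ContinuousOn f U) (h0 : ∀ x, x ∉ K → f x = 0) : Integrable f := by
  have h1 : IntegrableOn f K := (hf.mono hKU).integrableOn_compact hK
  rwa [integrableOn_iff_integrable_of_support_subset] at h1
  intro x hx
  by_contra hc
  exact hx (h0 x hc)

lemma contOn_pd {N : ℕ} {U : Set (Euc N)} (hU : IsOpen U) {f : Euc N → ℝ}
    (hf : ContDiffOn ℝ 1 f U) (i : Fin N) : ContinuousOn (pd f i) U := by
  have h1 := hf.continuousOn_fderiv_of_isOpen hU le_rfl
  exact h1.clm_apply continuousOn_const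

lemma ibp1 {N : ℕ} {U : Set (Euc N)} (hU : IsOpen U) (Y : Fin N → Euc N → ℝ)
    (hY : ∀ i, ContDiffOn ℝ 1 (Y i) U) (ψ : Euc N → ℝ) (hψ : ContDiff ℝ 1 ψ)
    (hc : HasCompactSupport ψ) (hs : tsupport ψ ⊆ U) :
    ∫ x, (ψ x * ∑ i, pd (Y i) i x + ∑ i, pd ψ i x * Y i x) = 0 := by
  have hpd0 : ∀ i, ∀ x, x ∉ tsupport ψ → pd ψ i x = 0 := by
    intro i x hx
    have : fderiv ℝ ψ x = 0 := by
      by_contra hcon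
      exact hx (support_fderiv_subset ℝ hcon)
    simp [pd, this]
  have hψ0 : ∀ x, x ∉ tsupport ψ → ψ x = 0 := fun x hx => image_eq_zero_of_notMem_tsupport hx
  have I1 : ∀ i, Integrable (fun x => pd (Y i) i x * ψ x) := fun i =>
    integrable_of_cont_cpt hc hs ((contOn_pd hU (hY i) i).mul hψ.continuous.continuousOn)
      (fun x hx => by simp [hψ0 x hx])
  have I2 : ∀ i, Integrable (fun x => Y i x * pd ψ i x) := fun i =>
    integrable_of_cont_cpt hc hs ((hY i).continuousOn.mul
      (contOn_pd hU hψ.contDiffOn i)) (fun x hx => by simp [hpd0 i x hx])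
  have I3 : ∀ i, Integrable (fun x => Y i x * ψ x) := fun i =>
    integrable_of_cont_cpt hc hs ((hY i).continuousOn.mul hψ.continuous.continuousOn)
      (fun x hx => by simp [hψ0 x hx])
  have key : ∀ i, ∫ x, (pd (Y i) i x * ψ x + Y i x * pd ψ i x) = 0 := by
    intro i
    rw [integral_add (I1 i) (I2 i)]
    have := integral_mul_fderiv_eq_neg_fderiv_mul_of_integrable (μ := volume)
      (v := EuclideanSpace.single i (1:ℝ)) (I1 i) (I2 i) (I3 i)
      (fun x hx => ((hY i).differentiableOn one_ne_zero x (hs hx)).differentiableAt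
        (hU.mem_nhds (hs hx)))
      (fun x _ => hψ.differentiable one_ne_zero x)
    simp only [pd]
    linarith
  have I12 : ∀ i, Integrable (fun x => pd (Y i) i x * ψ x + Y i x * pd ψ i x) := fun i =>
    (I1 i).add (I2 i)
  calc _ = ∫ x, ∑ i, (pd (Y i) i x * ψ x + Y i x * pd ψ i x) := by
        congr 1; ext x
        rw [Finset.sum_add_distrib, Finset.mul_sum]
        congr 1 <;> exact Finset.sum_congr rfl (fun i _ => mul_comm _ _)
    _ = 0 := by
        rw [integral_finsetSum _ (fun i _ => I12 i)]
        exact Finset.sum_eq_zero (fun i _ => key i)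

lemma slab_vol (N : ℕ) (h : 0 < N) (R δ : ℝ) (hR : 0 ≤ R) (hδ : 0 ≤ δ) :
    volume.real {x : Euc N | ‖x‖ ≤ R ∧ 0 ≤ x (lastIdx N h) ∧ x (lastIdx N h) ≤ 2 * δ}
      ≤ 2 * δ * (2 * R) ^ (N - 1) := by
  classical
  set B : Fin N → Set ℝ := fun i => if i = lastIdx N h then Icc 0 (2 * δ) else Icc (-R) R with hB
  have hsub : {x : Euc N | ‖x‖ ≤ R ∧ 0 ≤ x (lastIdx N h) ∧ x (lastIdx N h) ≤ 2 * δ} ⊆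
      (@WithLp.ofLp 2 (Fin N → ℝ)) ⁻¹' (Set.pi univ B) := by
    rintro x ⟨hx, h0, h1⟩ i _
    by_cases hi : i = lastIdx N h
    · simp only [hB, hi, if_true]; exact ⟨h0, h1⟩
    · simp only [hB, hi, if_false]
      have := (PiLp.norm_apply_le x i).trans hx
      exact abs_le.1 this
  have hmB : ∀ i, MeasurableSet (B i) := by
    intro i; simp only [hB]; split_ifs <;> exact measurableSet_Icc
  have hvol : volume ((@WithLp.ofLp 2 (Fin N → ℝ)) ⁻¹' (Set.pi univ B))
      = ENNReal.ofReal (2 * δ * (2 * R) ^ (N - 1)) := by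
    rw [(PiLp.volume_preserving_ofLp (Fin N)).measure_preimage
      (MeasurableSet.univ_pi hmB).nullMeasurableSet, volume_pi_pi,
      ← Finset.mul_prod_erase _ _ (Finset.mem_univ (lastIdx N h))]
    have e1 : volume (B (lastIdx N h)) = ENNReal.ofReal (2 * δ) := by simp [hB]
    have e2 : ∏ i ∈ Finset.univ.erase (lastIdx N h), volume (B i)
        = (ENNReal.ofReal (2 * R)) ^ (N - 1) := by
      rw [Finset.prod_congr rfl (g := fun _ => ENNReal.ofReal (2 * R))]
      · simp
      · intro i hi
        have := Finset.ne_of_mem_erase hi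
        simp only [hB, this, if_false, Real.volume_Icc]
        congr 1; ring
    rw [e1, e2, ENNReal.ofReal_mul (p := 2 * δ) (by positivity), ENNReal.ofReal_pow (by positivity)]
  rw [Measure.real]
  refine ENNReal.toReal_le_of_le_ofReal (by positivity) ?_
  rw [← hvol]
  exact measure_mono hsub

lemma exists_small (N : ℕ) (h : 0 < N) (f : Euc N → ℝ) (hf : ContinuousOn f (upperHSc N h))
    (hb : ∀ x ∈ bdryHS N h, f x = 0) (R : ℝ) (ε : ℝ) (hε : 0 < ε) :
    ∃ d > 0, ∀ x ∈ upperHSc N h, ‖x‖ ≤ R → x (lastIdx N h) < d → |f x| ≤ ε := by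
  have hK : IsCompact (upperHSc N h ∩ Metric.closedBall (0 : Euc N) R) :=
    (isCompact_closedBall _ _).inter_left (isClosed_upperHSc N h)
  have hu := hK.uniformContinuousOn_of_continuous (hf.mono inter_subset_left)
  obtain ⟨d, hd, hud⟩ := Metric.uniformContinuousOn_iff.1 hu ε hε
  refine ⟨d, hd, fun x hx hxR hxd => ?_⟩
  have hx0 : 0 ≤ x (lastIdx N h) := hx
  set z : Euc N := x - EuclideanSpace.single (lastIdx N h) (x (lastIdx N h)) with hz
  have hzl : z (lastIdx N h) = 0 := by simp [hz]
  have hzn : ‖z‖ ≤ ‖x‖ := by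
    rw [EuclideanSpace.norm_eq, EuclideanSpace.norm_eq]
    apply Real.sqrt_le_sqrt
    apply Finset.sum_le_sum
    intro i _
    by_cases hi : i = lastIdx N h
    · rw [hi, hzl]; simp [sq_nonneg]
    · simp [hz, hi]
  have hzb : z ∈ bdryHS N h := hzl
  have hzc : z ∈ upperHSc N h := by
    simp only [upperHSc, mem_ofPred_eq]; exact hzl.ge
  have := hud x ⟨hx, by simpa using hxR⟩ z ⟨hzc, by simpa using hzn.trans hxR⟩ (by
    rw [dist_eq_norm, hz]; simp [abs_of_nonneg hx0, hxd])
  rw [hb z hzb, Real.dist_eq, sub_zero] at this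
  exact this.le

lemma exists_eta : ∃ η : ℝ → ℝ, ContDiff ℝ 1 η ∧ (∀ t, t ≤ 1 → η t = 0) ∧ (∀ t, 2 ≤ t → η t = 1) ∧
    (∀ t, 0 ≤ η t) ∧ (∀ t, η t ≤ 1) ∧ (∀ t, 2 ≤ t → deriv η t = 0) ∧ (∀ t, t ≤ 1 → deriv η t = 0) ∧
    ∃ C, 0 ≤ C ∧ ∀ t, |deriv η t| ≤ C := by
  have hsm : ContDiff ℝ 1 (fun t => Real.smoothTransition (t - 1)) :=
    (Real.smoothTransition.contDiff (n := 1)).comp (contDiff_id.sub contDiff_const)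
  have h0 : ∀ t, t ≤ 1 → Real.smoothTransition (t - 1) = 0 := fun t ht =>
    Real.smoothTransition.zero_of_nonpos (by linarith)
  have h1 : ∀ t, 2 ≤ t → Real.smoothTransition (t - 1) = 1 := fun t ht =>
    Real.smoothTransition.one_of_one_le (by linarith)
  have hcd : Continuous (deriv (fun t => Real.smoothTransition (t - 1))) :=
    hsm.continuous_deriv le_rfl
  have hd1 : ∀ t, 2 ≤ t → deriv (fun t => Real.smoothTransition (t - 1)) t = 0 := by
    have hcl : IsClosed {t | deriv (fun t => Real.smoothTransition (t - 1)) t = 0} :=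
      isClosed_eq hcd continuous_const
    have hsub : Ioi (2:ℝ) ⊆ {t | deriv (fun t => Real.smoothTransition (t - 1)) t = 0} := by
      intro t ht
      have : (fun t => Real.smoothTransition (t - 1)) =ᶠ[𝓝 t] fun _ => 1 := by
        filter_upwards [Ioi_mem_nhds ht] with s hs using h1 s (le_of_lt hs)
      simp only [mem_ofPred_eq]
      rw [this.deriv_eq]; simp
    have := closure_minimal hsub hcl
    rw [closure_Ioi] at this
    exact fun t ht => this ht
  have hd0 : ∀ t, t ≤ 1 → deriv (fun t => Real.smoothTransition (t - 1)) t = 0 := by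
    have hcl : IsClosed {t | deriv (fun t => Real.smoothTransition (t - 1)) t = 0} :=
      isClosed_eq hcd continuous_const
    have hsub : Iio (1:ℝ) ⊆ {t | deriv (fun t => Real.smoothTransition (t - 1)) t = 0} := by
      intro t ht
      have : (fun t => Real.smoothTransition (t - 1)) =ᶠ[𝓝 t] fun _ => 0 := by
        filter_upwards [Iio_mem_nhds ht] with s hs using h0 s (le_of_lt hs)
      simp only [mem_ofPred_eq]
      rw [this.deriv_eq]; simp
    have := closure_minimal hsub hcl
    rw [closure_Iio] at this
    exact fun t ht => this ht
  refine ⟨_, hsm, h0, h1, fun t => Real.smoothTransition.nonneg _,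
    fun t => Real.smoothTransition.le_one _, hd1, hd0, ?_⟩
  obtain ⟨C, hC⟩ := (isCompact_Icc (a := (1:ℝ)) (b := 2)).exists_bound_of_continuousOn
    hcd.continuousOn
  refine ⟨max C 0, le_max_right _ _, fun t => ?_⟩
  by_cases ht1 : t ≤ 1
  · rw [hd0 t ht1]; simp
  by_cases ht2 : 2 ≤ t
  · rw [hd1 t ht2]; simp
  exact (hC t ⟨by linarith, by linarith⟩).trans (le_max_left _ _)

lemma divHS (N : ℕ) (h : 0 < N) (Y : Fin N → Euc N → ℝ)
    (hY1 : ∀ i, ContDiffOn ℝ 1 (Y i) (upperHS N h))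
    (hYc : ∀ i, ContinuousOn (Y i) (upperHSc N h))
    (hb : ∀ x ∈ bdryHS N h, Y (lastIdx N h) x = 0)
    (D : Euc N → ℝ) (hD : ContinuousOn D (upperHSc N h))
    (hdiv : ∀ x ∈ upperHS N h, ∑ i, pd (Y i) i x = D x)
    (φ : Euc N → ℝ) (hφ : ContDiff ℝ 1 φ) (R : ℝ) (hR : 0 ≤ R)
    (hs : tsupport φ ⊆ Metric.closedBall 0 R) :
    IntegrableOn (fun x => φ x * D x + ∑ i, pd φ i x * Y i x) (upperHS N h) ∧
    ∫ x in upperHS N h, (φ x * D x + ∑ i, pd φ i x * Y i x) = 0 := by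
  obtain ⟨η, hη, hη0, hη1, hηn, hηl, hd1, hd0, C, hC0, hC⟩ := exists_eta
  set L := lastIdx N h with hL
  have hHSo := isOpen_upperHS N h
  have hHSm : MeasurableSet (upperHS N h) := hHSo.measurableSet
  have hpd0 : ∀ i, ∀ x, x ∉ tsupport φ → pd φ i x = 0 := by
    intro i x hx
    have : fderiv ℝ φ x = 0 := by
      by_contra hcon
      exact hx (support_fderiv_subset ℝ hcon)
    simp [pd, this]
  have hφ0 : ∀ x, x ∉ tsupport φ → φ x = 0 := fun x hx => image_eq_zero_of_notMem_tsupport hx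
  have hcc : HasCompactSupport φ :=
    (isCompact_closedBall (0 : Euc N) R).of_isClosed_subset (isClosed_tsupport φ) hs
  set G : Euc N → ℝ := fun x => φ x * D x + ∑ i, pd φ i x * Y i x with hG
  have hG0 : ∀ x, x ∉ Metric.closedBall (0 : Euc N) R → G x = 0 := by
    intro x hx
    have hx' : x ∉ tsupport φ := fun hh => hx (hs hh)
    simp [hG, hφ0 x hx', hpd0 _ x hx']
  have hGc : ContinuousOn G (upperHSc N h) := by
    refine (hφ.continuous.continuousOn.mul hD).add (continuousOn_finsetSum _ fun i _ => ?_)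
    exact ((contOn_pd isOpen_univ hφ.contDiffOn i).mono (subset_univ _)).mul (hYc i)
  have hKc : IsCompact (upperHSc N h ∩ Metric.closedBall (0 : Euc N) R) :=
    (isCompact_closedBall _ _).inter_left (isClosed_upperHSc N h)
  have hGi : IntegrableOn G (upperHS N h) := by
    have h1 : IntegrableOn G (upperHSc N h ∩ Metric.closedBall (0 : Euc N) R) :=
      (hGc.mono inter_subset_left).integrableOn_compact hKc
    refine h1.of_forall_sdiff_eq_zero hHSm ?_
    rintro x ⟨hx, hx'⟩
    exact hG0 x (fun hh => hx' ⟨upperHS_subset N h hx, hh⟩)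
  refine ⟨hGi, ?_⟩
  -- the identity for fixed delta
  have key : ∀ δ : ℝ, 0 < δ →
      ∫ x in upperHS N h, (η (x L / δ) * G x + φ x * Y L x * (deriv η (x L / δ) / δ)) = 0 := by
    intro δ hδ
    have hηδ : ContDiff ℝ 1 (fun x : Euc N => η (x L / δ)) := by
      refine hη.comp ?_
      have : ContDiff ℝ 1 (fun x : Euc N => x L) := by fun_prop
      exact this.div_const δ
    have hψ : ContDiff ℝ 1 (fun x : Euc N => φ x * η (x L / δ)) := hφ.mul hηδ
    have hψz : ∀ x : Euc N, x L ≤ δ → η (x L / δ) = 0 := fun x hx =>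
      hη0 _ ((div_le_one hδ).2 hx)
    have hts : tsupport (fun x : Euc N => φ x * η (x L / δ)) ⊆
        tsupport φ ∩ {x : Euc N | δ ≤ x L} := by
      apply closure_minimal
      · intro x hx
        refine ⟨subset_tsupport φ (fun h0 => hx (by simp [h0])), ?_⟩
        simp only [mem_ofPred_eq]
        by_contra hcon
        exact hx (by simp [hψz x (not_le.1 hcon).le])
      · refine (isClosed_tsupport φ).inter ?_
        have : Continuous (fun x : Euc N => x L) := by fun_prop
        exact isClosed_le continuous_const this
    have hfd : ∀ i x, pd (fun x : Euc N => φ x * η (x L / δ)) i x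
        = pd φ i x * η (x L / δ) + φ x * (if i = L then deriv η (x L / δ) / δ else 0) := by
      intro i x
      have a1 : HasFDerivAt φ (fderiv ℝ φ x) x := (hφ.differentiable one_ne_zero x).hasFDerivAt
      have a2 : HasDerivAt η (deriv η (x L / δ)) (x L / δ) :=
        (hη.differentiable one_ne_zero _).hasDerivAt
      have a3 : HasFDerivAt (fun x : Euc N => x L / δ)
          ((δ⁻¹ : ℝ) • (EuclideanSpace.proj L : Euc N →L[ℝ] ℝ)) x := by
        have := (EuclideanSpace.proj L : Euc N →L[ℝ] ℝ).hasFDerivAt (x := x)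
        have := this.const_mul (δ⁻¹)
        refine this.congr_of_eventuallyEq (Eventually.of_forall fun y => ?_)
        simp [div_eq_inv_mul]
      have a4 := a2.comp_hasFDerivAt x a3
      have a5 := a1.mul a4
      have a6 : fderiv ℝ (fun x : Euc N => φ x * η (x L / δ)) x = _ := a5.fderiv
      simp only [pd, a6]
      by_cases hi : i = L
      · simp [hi]; ring
      · simp [hi, Ne.symm hi]; ring
    have hz := ibp1 hHSo Y hY1 _ hψ
      (hcc.of_isClosed_subset (isClosed_tsupport _) (hts.trans inter_subset_left))
      (fun x hx => by
        have := (hts hx).2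
        simp only [mem_ofPred_eq] at this
        simp only [upperHS, mem_ofPred_eq]; exact hδ.trans_le this)
    rw [← hz, setIntegral_eq_integral_of_forall_compl_eq_zero]
    · congr 1; ext x
      have e1 : ∑ i, pd (fun x : Euc N => φ x * η (x L / δ)) i x * Y i x
          = η (x L / δ) * (∑ i, pd φ i x * Y i x) + φ x * Y L x * (deriv η (x L / δ) / δ) := by
        simp only [hfd, add_mul, Finset.sum_add_distrib, Finset.mul_sum]
        congr 1
        · exact Finset.sum_congr rfl (fun i _ => by ring)
        · simp; ring
      rw [e1]
      by_cases hx : x ∈ upperHS N h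
      · rw [hdiv x hx]; simp only [hG]; ring
      · have hx' : x L ≤ 0 := by
          simp only [upperHS, mem_ofPred_eq, not_lt] at hx; exact hx
        rw [hψz x (hx'.trans hδ.le)]; ring
    · intro x hx
      have hx' : x L ≤ 0 := by
        simp only [upperHS, mem_ofPred_eq, not_lt] at hx; exact hx
      rw [hψz x (hx'.trans hδ.le), hd0 (x L / δ) ((div_nonpos_of_nonpos_of_nonneg hx' hδ.le).trans
        zero_le_one)]
      simp
  have hcoordL : Continuous (fun x : Euc N => x L) := by fun_prop
  have hdc : Continuous (deriv η) := hη.continuous_deriv le_rfl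
  -- integrability of the pieces
  have hIa : ∀ δ : ℝ, 0 < δ → IntegrableOn (fun x => η (x L / δ) * G x) (upperHS N h) := by
    intro δ hδ
    refine Integrable.mono' hGi.norm ?_ (Eventually.of_forall fun x => ?_)
    · exact ((hη.continuous.comp (hcoordL.div_const δ)).aestronglyMeasurable).mul
        hGi.aestronglyMeasurable
    · rw [norm_mul, Real.norm_of_nonneg (hηn _)]
      exact mul_le_of_le_one_left (norm_nonneg _) (hηl _)
  have hfc : ContinuousOn (fun x => φ x * Y L x) (upperHSc N h) :=
    hφ.continuous.continuousOn.mul (hYc L)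
  have hIb : ∀ δ : ℝ, 0 < δ →
      IntegrableOn (fun x => φ x * Y L x * (deriv η (x L / δ) / δ)) (upperHS N h) := by
    intro δ hδ
    have hcc2 : ContinuousOn (fun x => φ x * Y L x * (deriv η (x L / δ) / δ)) (upperHSc N h) :=
      hfc.mul ((hdc.comp (hcoordL.div_const δ)).div_const δ).continuousOn
    have h1 := (hcc2.mono (inter_subset_left (t := Metric.closedBall (0 : Euc N) R))
      ).integrableOn_compact (μ := volume) hKc
    refine h1.of_forall_sdiff_eq_zero hHSm ?_
    rintro x ⟨hx, hx'⟩
    have : x ∉ tsupport φ := fun hh => hx' ⟨upperHS_subset N h hx, hs hh⟩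
    simp [hφ0 x this]
  have hsum : ∀ δ : ℝ, 0 < δ → ∫ x in upperHS N h, η (x L / δ) * G x =
      - ∫ x in upperHS N h, φ x * Y L x * (deriv η (x L / δ) / δ) := by
    intro δ hδ
    have := key δ hδ
    rw [integral_add (hIa δ hδ) (hIb δ hδ)] at this
    linarith
  have hδn : Tendsto (fun n : ℕ => (1:ℝ) / (n + 1)) atTop (𝓝 0) :=
    tendsto_one_div_add_atTop_nhds_zero_nat
  have lim1 : Tendsto (fun n : ℕ => ∫ x in upperHS N h, η (x L / ((1:ℝ) / (n + 1))) * G x) atTop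
      (𝓝 (∫ x in upperHS N h, G x)) := by
    refine tendsto_integral_of_dominated_convergence (fun x => ‖G x‖)
      (fun n => (hIa _ (by positivity)).aestronglyMeasurable) hGi.norm
      (fun n => Eventually.of_forall fun x => ?_) ?_
    · rw [norm_mul, Real.norm_of_nonneg (hηn _)]
      exact mul_le_of_le_one_left (norm_nonneg _) (hηl _)
    · refine (ae_restrict_iff' hHSm).2 (Eventually.of_forall fun x hx => ?_)
      have hx' : 0 < x L := hx
      refine tendsto_const_nhds.congr' ?_
      filter_upwards [hδn.eventually (gt_mem_nhds (half_pos hx'))] with n hn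
      rw [hη1, one_mul]
      rw [le_div_iff₀ (by positivity)]; linarith
  have lim2 : Tendsto (fun n : ℕ => ∫ x in upperHS N h,
      φ x * Y L x * (deriv η (x L / ((1:ℝ) / (n + 1))) / ((1:ℝ) / (n + 1)))) atTop (𝓝 0) := by
    rw [Metric.tendsto_atTop']
    intro ε hε
    set M : ℝ := C * 2 * (2 * R) ^ (N - 1) + 1 with hM
    have hM0 : 0 < M := by positivity
    obtain ⟨d, hd, hsm⟩ := exists_small N h (fun x => φ x * Y L x) hfc
      (fun x hx => by simp [hb x hx]) R (ε / (2 * M)) (by positivity)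
    obtain ⟨n0, hn0⟩ := (hδn.eventually (gt_mem_nhds (half_pos hd))).exists_forall_of_atTop
    refine ⟨n0, fun n hn => ?_⟩
    have hδd := hn0 n hn.le
    generalize hδ : (1:ℝ) / (n + 1) = δ at *
    have hδ0 : 0 < δ := by rw [← hδ]; positivity
    set S : Set (Euc N) := {x : Euc N | ‖x‖ ≤ R ∧ 0 ≤ x (lastIdx N h) ∧ x (lastIdx N h) ≤ 2 * δ}
      with hS
    have hSm : MeasurableSet S := by
      have c1 : IsClosed {x : Euc N | ‖x‖ ≤ R} := isClosed_le continuous_norm continuous_const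
      have c2 : IsClosed {x : Euc N | 0 ≤ x (lastIdx N h)} := isClosed_le continuous_const hcoordL
      have c3 : IsClosed {x : Euc N | x (lastIdx N h) ≤ 2 * δ} :=
        isClosed_le hcoordL continuous_const
      exact (c1.inter (c2.inter c3)).measurableSet
    have hSf : volume S < ⊤ := by
      refine lt_of_le_of_lt (measure_mono (t := Metric.closedBall (0 : Euc N) R) ?_)
        (isCompact_closedBall (0 : Euc N) R).measure_lt_top
      rintro x ⟨hx, -⟩
      simpa using hx
    have e1 : ∫ x in upperHS N h, φ x * Y L x * (deriv η (x L / δ) / δ)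
        = ∫ x in upperHS N h ∩ S, φ x * Y L x * (deriv η (x L / δ) / δ) := by
      refine setIntegral_eq_of_subset_of_forall_sdiff_eq_zero hHSm inter_subset_left ?_
      rintro x ⟨hx, hx'⟩
      have hx0 : 0 < x L := hx
      by_cases hxR : ‖x‖ ≤ R
      · have : 2 * δ < x L := by
          by_contra hcon
          exact hx' ⟨hx, hxR, hx0.le, not_lt.1 hcon⟩
        rw [hd1 (x L / δ) (by rw [le_div_iff₀ hδ0]; linarith)]; simp
      · have : x ∉ tsupport φ := fun hh => hxR (by simpa using hs hh)
        simp [hφ0 x this]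
    have hvol : volume.real (upperHS N h ∩ S) ≤ 2 * δ * (2 * R) ^ (N - 1) :=
      (measureReal_mono inter_subset_right hSf.ne).trans (slab_vol N h R δ hR hδ0.le)
    have e2 : ‖∫ x in upperHS N h ∩ S, φ x * Y L x * (deriv η (x L / δ) / δ)‖
        ≤ (ε / (2 * M) * (C / δ)) * volume.real (upperHS N h ∩ S) := by
      refine norm_setIntegral_le_of_norm_le_const
        ((measure_mono inter_subset_right).trans_lt hSf) ?_
      rintro x ⟨hx, hx1, hx2, hx3⟩
      rw [norm_mul, norm_div, Real.norm_of_nonneg hδ0.le]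
      have := hsm x (upperHS_subset N h hx) hx1 (by linarith)
      simp only [Real.norm_eq_abs]
      gcongr
      exact hC _
    rw [dist_zero_right, e1]
    refine e2.trans_lt ?_
    calc (ε / (2 * M) * (C / δ)) * volume.real (upperHS N h ∩ S)
        ≤ (ε / (2 * M) * (C / δ)) * (2 * δ * (2 * R) ^ (N - 1)) := by gcongr
      _ = ε / (2 * M) * (M - 1) := by rw [hM]; field_simp; ring
      _ < ε / (2 * M) * (2 * M) := by
          have : 0 < ε / (2 * M) := by positivity
          gcongr
          linarith
      _ = ε := by field_simp
  have lim3 := lim2.neg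
  rw [neg_zero] at lim3
  refine tendsto_nhds_unique lim1 (lim3.congr fun n => (hsum _ (by positivity)).symm)

lemma gder {r : ℝ} (hr : 0 < r) (s : ℝ) :
    HasDerivAt (fun s : ℝ => |s| ^ r * s) ((r + 1) * |s| ^ r) s := by
  rcases lt_trichotomy s 0 with hs | hs | hs
  · have h1 : HasDerivAt (fun s : ℝ => -((-s) ^ (r + 1))) ((r + 1) * |s| ^ r) s := by
      have := ((hasDerivAt_neg s).rpow_const (p := r + 1) (Or.inl (by linarith))).fun_neg
      refine this.congr_deriv ?_
      rw [abs_of_neg hs, add_sub_cancel_right]; ring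
    refine h1.congr_of_eventuallyEq ?_
    filter_upwards [gt_mem_nhds hs] with t ht
    rw [abs_of_neg ht, Real.rpow_add_one (by linarith)]; ring
  · subst hs
    rw [hasDerivAt_iff_tendsto_slope]
    have h1 : Tendsto (fun t : ℝ => |t| ^ r) (𝓝[≠] 0) (𝓝 ((r + 1) * |(0:ℝ)| ^ r)) := by
      have hc : Continuous (fun t : ℝ => |t| ^ r) :=
        continuous_abs.rpow_const (fun _ => Or.inr hr.le)
      have := hc.tendsto 0
      simp only [abs_zero, Real.zero_rpow hr.ne', mul_zero] at this ⊢
      exact this.mono_left nhdsWithin_le_nhds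
    refine h1.congr' ?_
    filter_upwards [self_mem_nhdsWithin] with t ht
    have ht' : t ≠ 0 := ht
    simp only [slope_def_field, abs_zero, mul_zero, sub_zero]
    field_simp
  · have h1 : HasDerivAt (fun s : ℝ => s ^ (r + 1)) ((r + 1) * |s| ^ r) s := by
      have := Real.hasDerivAt_rpow_const (x := s) (p := r + 1) (Or.inl hs.ne')
      convert this using 1
      rw [abs_of_pos hs, add_sub_cancel_right]
    refine h1.congr_of_eventuallyEq ?_
    filter_upwards [lt_mem_nhds hs] with t ht
    rw [abs_of_pos ht, Real.rpow_add_one (by linarith)]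

lemma contDiff_one_of_hasDerivAt {f f' : ℝ → ℝ} (h : ∀ s, HasDerivAt f (f' s) s)
    (hc : Continuous f') : ContDiff ℝ 1 f := by
  rw [contDiff_one_iff_deriv]
  refine ⟨fun s => (h s).differentiableAt, ?_⟩
  have : deriv f = f' := funext fun s => (h s).deriv
  rw [this]; exact hc

lemma cont_abs_rpow {r : ℝ} (hr : 0 ≤ r) : Continuous (fun s : ℝ => |s| ^ r) :=
  continuous_abs.rpow_const (fun _ => Or.inr hr)

lemma gC1 {r : ℝ} (hr : 0 < r) : ContDiff ℝ 1 (fun s : ℝ => |s| ^ r * s) :=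
  contDiff_one_of_hasDerivAt (gder hr) (continuous_const.mul (cont_abs_rpow hr.le))

lemma absC1 {r : ℝ} (hr : 2 < r) : ContDiff ℝ 1 (fun s : ℝ => |s| ^ r) :=
  contDiff_one_of_hasDerivAt (fun s => hasDerivAt_abs_rpow s (by linarith))
    ((continuous_const.mul (cont_abs_rpow (by linarith))).mul continuous_id)

lemma maxsq_der (t : ℝ) : HasDerivAt (fun t : ℝ => (max t 0) ^ 2) (2 * max t 0) t := by
  have h1 := (((hasDerivAt_id t).pow 2).add (gder one_pos t)).div_const 2
  have e : (fun t : ℝ => (max t 0) ^ 2) =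
      fun t => ((id ^ 2 + fun s : ℝ => |s| ^ (1:ℝ) * s) : ℝ → ℝ) t / 2 := by
    ext s
    simp only [Pi.add_apply, Pi.pow_apply, id, Real.rpow_one]
    rcases le_total 0 s with hs | hs
    · rw [max_eq_left hs, abs_of_nonneg hs]; ring
    · rw [max_eq_right hs, abs_of_nonpos hs]; ring
  rw [e]
  refine h1.congr_deriv ?_
  simp only [Real.rpow_one, id]
  rcases le_total 0 t with hs | hs
  · rw [max_eq_left hs, abs_of_nonneg hs]; norm_num
  · rw [max_eq_right hs, abs_of_nonpos hs]; norm_num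

/-- base of the cutoff -/
def cutm {N : ℕ} (R : ℝ) (x : Euc N) : ℝ := max (1 - ‖x‖ ^ 2 / R ^ 2) 0

lemma cutm_nonneg {N : ℕ} (R : ℝ) (x : Euc N) : 0 ≤ cutm R x := le_max_right _ _

lemma cutm_le_one {N : ℕ} (R : ℝ) (x : Euc N) : cutm R x ≤ 1 := by
  refine max_le ?_ zero_le_one
  have : 0 ≤ ‖x‖ ^ 2 / R ^ 2 := by positivity
  linarith

lemma cutm_zero {N : ℕ} {R : ℝ} (hR : 0 < R) (x : Euc N) (hx : R ≤ ‖x‖) : cutm R x = 0 := by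
  refine max_eq_right ?_
  have : 1 ≤ ‖x‖ ^ 2 / R ^ 2 := by
    rw [le_div_iff₀ (by positivity), one_mul]; gcongr
  linarith

lemma cut_C1 {N : ℕ} (R : ℝ) : ContDiff ℝ 1 (fun x : Euc N => (cutm R x) ^ 2) := by
  have h1 : ContDiff ℝ 1 (fun t : ℝ => (max t 0) ^ 2) :=
    contDiff_one_of_hasDerivAt maxsq_der (by fun_prop)
  have h2 : ContDiff ℝ 1 (fun x : Euc N => 1 - ‖x‖ ^ 2 / R ^ 2) :=
    contDiff_const.sub ((contDiff_norm_sq ℝ).div_const _)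
  exact h1.comp h2

lemma cut_pd {N : ℕ} (R : ℝ) (i : Fin N) (x : Euc N) :
    pd (fun x : Euc N => (cutm R x) ^ 2) i x = -(4 * cutm R x / R ^ 2) * x i := by
  have h2 : HasFDerivAt (fun x : Euc N => ‖x‖ ^ 2) (2 • (innerSL ℝ x)) x :=
    (hasStrictFDerivAt_norm_sq x).hasFDerivAt
  have h3 : HasFDerivAt (fun x : Euc N => 1 - ‖x‖ ^ 2 / R ^ 2)
      (-((R ^ 2)⁻¹ • (2 • (innerSL ℝ x)))) x := by
    have := (h2.const_mul ((R ^ 2)⁻¹)).const_sub 1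
    refine this.congr_of_eventuallyEq (Eventually.of_forall fun y => ?_)
    simp [div_eq_inv_mul]
  have h4 := (maxsq_der (1 - ‖x‖ ^ 2 / R ^ 2)).comp_hasFDerivAt x h3
  have h5 : fderiv ℝ (fun x : Euc N => (cutm R x) ^ 2) x = _ := h4.fderiv
  rw [pd, h5]
  simp [cutm, EuclideanSpace.inner_single_right]
  ring

lemma cut_tsupport {N : ℕ} {R : ℝ} (hR : 0 < R) :
    tsupport (fun x : Euc N => (cutm R x) ^ 2) ⊆ Metric.closedBall 0 R := by
  apply closure_minimal _ Metric.isClosed_closedBall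
  intro x hx
  by_contra hcon
  apply hx
  have : R ≤ ‖x‖ := by
    rw [mem_closedBall_zero_iff, not_le] at hcon; exact hcon.le
  simp [cutm_zero hR x this]

/-- `divHS` with the explicit cutoff -/
lemma divHS_cut (N : ℕ) (h : 0 < N) (Y : Fin N → Euc N → ℝ)
    (hY1 : ∀ i, ContDiffOn ℝ 1 (Y i) (upperHS N h))
    (hYc : ∀ i, ContinuousOn (Y i) (upperHSc N h))
    (hb : ∀ x ∈ bdryHS N h, Y (lastIdx N h) x = 0)
    (D : Euc N → ℝ) (hD : ContinuousOn D (upperHSc N h))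
    (hdiv : ∀ x ∈ upperHS N h, ∑ i, pd (Y i) i x = D x) (R : ℝ) (hR : 0 < R) :
    IntegrableOn (fun x => (cutm R x) ^ 2 * D x - (4 * cutm R x / R ^ 2) * ∑ i, x i * Y i x)
      (upperHS N h) ∧
    ∫ x in upperHS N h, ((cutm R x) ^ 2 * D x - (4 * cutm R x / R ^ 2) * ∑ i, x i * Y i x) = 0 := by
  have := divHS N h Y hY1 hYc hb D hD hdiv _ (cut_C1 R) R hR.le (cut_tsupport hR)
  have e : (fun x => (cutm R x) ^ 2 * D x - (4 * cutm R x / R ^ 2) * ∑ i, x i * Y i x)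
      = fun x => (cutm R x) ^ 2 * D x + ∑ i, pd (fun x : Euc N => (cutm R x) ^ 2) i x * Y i x := by
    ext x
    rw [Finset.mul_sum, sub_eq_add_neg, ← Finset.sum_neg_distrib]
    congr 1
    exact Finset.sum_congr rfl fun i _ => by rw [cut_pd]; ring
  rw [e]; exact this

/-- partial derivatives up to the boundary -/
def PP (N : ℕ) (h : 0 < N) (u : Euc N → ℝ) (i : Fin N) (x : Euc N) : ℝ :=
  fderivWithin ℝ u (upperHSc N h) x (EuclideanSpace.single i 1)

lemma upperHSc_mem_nhds {N : ℕ} {h : 0 < N} {x : Euc N} (hx : x ∈ upperHS N h) :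
    upperHSc N h ∈ 𝓝 x :=
  mem_of_superset ((isOpen_upperHS N h).mem_nhds hx) (upperHS_subset N h)

lemma PP_eq {N : ℕ} {h : 0 < N} (u : Euc N → ℝ) (i : Fin N) {x : Euc N} (hx : x ∈ upperHS N h) :
    PP N h u i x = pd u i x := by
  rw [PP, pd, fderivWithin_of_mem_nhds (upperHSc_mem_nhds hx)]

lemma PP_C1 {N : ℕ} {h : 0 < N} {u : Euc N → ℝ} (hu : ContDiffOn ℝ 2 u (upperHS N h)) (i : Fin N) :
    ContDiffOn ℝ 1 (PP N h u i) (upperHS N h) := by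
  have h1 : ContDiffOn ℝ 1 (fderiv ℝ u) (upperHS N h) :=
    hu.fderiv_of_isOpen (isOpen_upperHS N h) (by norm_num)
  have h2 : ContDiffOn ℝ 1 (pd u i) (upperHS N h) := h1.clm_apply contDiffOn_const
  exact h2.congr fun x hx => PP_eq u i hx

lemma uniqueDiff_upperHSc (N : ℕ) (h : 0 < N) : UniqueDiffOn ℝ (upperHSc N h) := by
  apply uniqueDiffOn_convex
  · intro x hx y hy a b ha hb hab
    simp only [upperHSc, mem_ofPred_eq] at *
    simp only [PiLp.add_apply, PiLp.smul_apply, smul_eq_mul]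
    positivity
  · refine ⟨EuclideanSpace.single (lastIdx N h) 1, ?_⟩
    refine mem_interior_iff_mem_nhds.2 (upperHSc_mem_nhds ?_)
    simp [upperHS]

lemma PP_cont {N : ℕ} {h : 0 < N} {u : Euc N → ℝ} (hu : ContDiffOn ℝ 1 u (upperHSc N h))
    (i : Fin N) : ContinuousOn (PP N h u i) (upperHSc N h) :=
  (hu.continuousOn_fderivWithin (uniqueDiff_upperHSc N h) le_rfl).clm_apply continuousOn_const

lemma line_coord {N : ℕ} (x : Euc N) (i j : Fin N) :
    HasDerivAt (fun t : ℝ => (x + t • (EuclideanSpace.single i (1:ℝ) : Euc N)) j)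
      (if i = j then 1 else 0) 0 := by
  have h1 : HasDerivAt (fun t : ℝ => x j + t * (if i = j then 1 else 0))
      (if i = j then 1 else 0) 0 := by
    have := ((hasDerivAt_id (0:ℝ)).mul_const (if i = j then (1:ℝ) else 0)).const_add (x j)
    simpa using this
  refine h1.congr_of_eventuallyEq (Eventually.of_forall fun t => ?_)
  simp [eq_comm]

lemma line_of_diff {N : ℕ} {f : Euc N → ℝ} {x : Euc N} (hf : DifferentiableAt ℝ f x) (i : Fin N) :
    HasDerivAt (fun t : ℝ => f (x + t • (EuclideanSpace.single i (1:ℝ) : Euc N))) (pd f i x) 0 :=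
  hf.hasFDerivAt.hasLineDerivAt _

/-- Pohozaev-type vector field. -/
def Y2 (N : ℕ) (L : Fin N) (c s : ℝ) (u : Euc N → ℝ) (P : Fin N → Euc N → ℝ) (F g hh : ℝ → ℝ)
    (i : Fin N) (y : Euc N) : ℝ :=
  -(P i y * ∑ j, y j * P j y) + y i * ((∑ j, (P j y) ^ 2) / 2) - y i * F (u y)
    - c * (u y * P i y + y i * ((u y) ^ 2 / 4))
    - s * ((if i = L then 1 else 0) * ((∑ j, y j * P j y) * g (u y) + ((N : ℝ) - 1) * hh (u y))
        - y i * (g (u y) * P L y))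

lemma Y2_div {N : ℕ} (L : Fin N) (c s : ℝ) (hc : c = ((N : ℝ) - 2) / 2) (u : Euc N → ℝ)
    (P : Fin N → Euc N → ℝ)
    (F g hh : ℝ → ℝ) (x : Euc N) (f' g' : ℝ)
    (hu : DifferentiableAt ℝ u x) (hup : ∀ i, pd u i x = P i x)
    (hP : ∀ i, DifferentiableAt ℝ (P i) x)
    (hsym : ∀ i j, pd (P j) i x = pd (P i) j x)
    (hF : HasDerivAt F f' (u x)) (hg : HasDerivAt g g' (u x)) (hh' : HasDerivAt hh (g (u x)) (u x))
    (hY : ∀ i, DifferentiableAt ℝ (Y2 N L c s u P F g hh i) x) :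
    ∑ i, pd (Y2 N L c s u P F g hh i) i x =
      -((∑ i, pd (P i) i x) + f') * (∑ j, x j * P j x) - N * F (u x)
        - c * (u x * (∑ i, pd (P i) i x) + N * (u x) ^ 2 / 4 + u x * (∑ j, x j * P j x) / 2) := by
  set Rad := ∑ j, x j * P j x with hRad
  set Sq := ∑ j, (P j x) ^ 2 with hSq
  set T : Fin N → ℝ := fun i => ∑ j, x j * pd (P j) i x with hT
  have E : ∀ i, pd (Y2 N L c s u P F g hh i) i x =
      (-Rad) * pd (P i) i x + (-1) * (P i x) ^ 2 + (-1) * (P i x * T i) + Sq / 2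
      + x i * (∑ j, P j x * pd (P j) i x) + (-F (u x)) + (-f') * (x i * P i x)
      + (-c) * (P i x) ^ 2 + (-c * u x) * pd (P i) i x + (-c * (u x) ^ 2 / 4)
      + (-c * u x / 2) * (x i * P i x) + s * g (u x) * P L x
      + (s * g' * P L x) * (x i * P i x) + (s * g (u x)) * (x i * pd (P L) i x)
      + (if i = L then 1 else 0) * (-s * ((P L x + T L) * g (u x) + Rad * (g' * P L x)
          + ((N : ℝ) - 1) * (g (u x) * P L x))) := by
    intro i
    have h0 : x + (0:ℝ) • (EuclideanSpace.single i (1:ℝ) : Euc N) = x := by simp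
    have du := line_of_diff hu i
    rw [hup] at du
    have dP : ∀ j, _ := fun j => line_of_diff (hP j) i
    have dc : ∀ j, _ := fun j => line_coord x i j
    have dRad : HasDerivAt (fun t : ℝ => ∑ j, (x + t • (EuclideanSpace.single i (1:ℝ) : Euc N)) j *
        P j (x + t • (EuclideanSpace.single i (1:ℝ) : Euc N))) (P i x + T i) 0 := by
      have := HasDerivAt.fun_sum (u := Finset.univ) (fun j _ => (dc j).fun_mul (dP j))
      refine this.congr_deriv ?_
      simp only [h0, Finset.sum_add_distrib, hT]
      simp
    have dSq : HasDerivAt (fun t : ℝ => ∑ j,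
        (P j (x + t • (EuclideanSpace.single i (1:ℝ) : Euc N))) ^ 2)
        (2 * ∑ j, P j x * pd (P j) i x) 0 := by
      have := HasDerivAt.fun_sum (u := Finset.univ) (fun j _ => (dP j).fun_pow 2)
      refine this.congr_deriv ?_
      rw [Finset.mul_sum]
      refine Finset.sum_congr rfl fun j _ => ?_
      rw [h0]; norm_num; ring
    have dF := HasDerivAt.comp_of_eq 0 hF du (by rw [h0])
    have dg := HasDerivAt.comp_of_eq 0 hg du (by rw [h0])
    have dh := HasDerivAt.comp_of_eq 0 hh' du (by rw [h0])
    have main := (((((dP i).fun_mul dRad).fun_neg.fun_add ((dc i).fun_mul (dSq.div_const 2))).fun_sub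
      ((dc i).fun_mul dF)).fun_sub
      (((du.fun_mul (dP i)).fun_add ((dc i).fun_mul ((du.fun_pow 2).div_const 4))).const_mul c)).fun_sub
      (((((dRad.fun_mul dg).fun_add (dh.const_mul ((N:ℝ) - 1))).const_mul
        (if i = L then (1:ℝ) else 0)).fun_sub ((dc i).fun_mul (dg.fun_mul (dP L)))).const_mul s)
    have := (line_of_diff (hY i) i).unique main
    rw [this]
    simp only [h0, Function.comp_apply, if_true, ← hRad, ← hSq]
    by_cases hi : i = L
    · subst hi
      simp only [if_true]
      norm_num
      ring
    · simp only [hi, if_false]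
      norm_num
      ring
  simp only [E, Finset.sum_add_distrib, ← Finset.mul_sum, Finset.sum_const, Finset.card_univ,
    Fintype.card_fin, nsmul_eq_mul, ite_mul, one_mul, zero_mul, Finset.sum_ite_eq', Finset.mem_univ,
    if_true, ← hRad, ← hSq]
  have s1 : ∑ i, x i * (∑ j, P j x * pd (P j) i x) = ∑ i, P i x * T i := by
    simp only [hT, Finset.mul_sum]
    rw [Finset.sum_comm]
    refine Finset.sum_congr rfl fun i _ => Finset.sum_congr rfl fun j _ => ?_
    rw [hsym]; ring
  have s2 : ∑ i, x i * pd (P L) i x = T L := by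
    simp only [hT]
    exact Finset.sum_congr rfl fun i _ => by rw [hsym]
  rw [s1, s2, hc]
  ring

/-- energy vector field -/
def Y1 (N : ℕ) (L : Fin N) (s : ℝ) (u : Euc N → ℝ) (P : Fin N → Euc N → ℝ) (hh : ℝ → ℝ)
    (i : Fin N) (y : Euc N) : ℝ :=
  u y * P i y + s * ((if i = L then 1 else 0) * hh (u y))

lemma Y1_div {N : ℕ} (L : Fin N) (s : ℝ) (u : Euc N → ℝ)
    (P : Fin N → Euc N → ℝ) (hh : ℝ → ℝ) (x : Euc N) (h' : ℝ)
    (hu : DifferentiableAt ℝ u x) (hup : ∀ i, pd u i x = P i x)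
    (hP : ∀ i, DifferentiableAt ℝ (P i) x) (hh' : HasDerivAt hh h' (u x))
    (hY : ∀ i, DifferentiableAt ℝ (Y1 N L s u P hh i) x) :
    ∑ i, pd (Y1 N L s u P hh i) i x =
      (∑ j, (P j x) ^ 2) + u x * (∑ i, pd (P i) i x) + s * h' * P L x := by
  have E : ∀ i, pd (Y1 N L s u P hh i) i x =
      (P i x) ^ 2 + u x * pd (P i) i x + (if i = L then 1 else 0) * (s * h' * P L x) := by
    intro i
    have h0 : x + (0:ℝ) • (EuclideanSpace.single i (1:ℝ) : Euc N) = x := by simp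
    have du := line_of_diff hu i
    rw [hup] at du
    have dP : ∀ j, _ := fun j => line_of_diff (hP j) i
    have dh := HasDerivAt.comp_of_eq 0 hh' du (by rw [h0])
    have main := (du.fun_mul (dP i)).fun_add ((dh.const_mul (if i = L then (1:ℝ) else 0)).const_mul s)
    have := (line_of_diff (hY i) i).unique main
    rw [this]
    simp only [h0]
    by_cases hi : i = L
    · subst hi
      simp only [if_true]
      ring
    · simp only [hi, if_false]
      ring
  simp only [E, Finset.sum_add_distrib, ← Finset.mul_sum, ite_mul, one_mul, zero_mul,
    Finset.sum_ite_eq', Finset.mem_univ, if_true]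

lemma abs_rpow_mul_mul {r : ℝ} (hr : 0 < r + 2) (t : ℝ) : |t| ^ r * t * t = |t| ^ (r + 2) := by
  by_cases ht : t = 0
  · subst ht; simp [Real.zero_rpow hr.ne']
  · have h1 : 0 < |t| := abs_pos.2 ht
    rw [Real.rpow_add h1, mul_assoc, ← abs_mul_abs_self t]
    congr 1
    rw [Real.rpow_two]; ring

lemma abs_rpow_sub_mul {r : ℝ} (hr : 0 < r) (t : ℝ) : |(|t| ^ (r - 1) * t)| = |t| ^ r := by
  by_cases ht : t = 0
  · subst ht; simp [Real.zero_rpow hr.ne']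
  · have h1 : 0 < |t| := abs_pos.2 ht
    rw [abs_mul, abs_of_nonneg (by positivity), Real.rpow_sub_one h1.ne']
    field_simp

lemma abs_rpow_add_one {r : ℝ} (hr : 0 < r) (t : ℝ) : |t| ^ (r + 1) = |t| * |t| ^ r := by
  by_cases ht : t = 0
  · subst ht
    have : r + 1 ≠ 0 := by linarith
    simp [Real.zero_rpow this]
  · have h1 : 0 < |t| := abs_pos.2 ht
    rw [Real.rpow_add_one h1.ne', mul_comm]

lemma abs_rpow_two_mul (r : ℝ) (t : ℝ) : |t| ^ (2 * r) = (|t| ^ r) ^ 2 := by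
  rw [mul_comm, Real.rpow_mul (abs_nonneg t), Real.rpow_two]

/-- interpolation of the subcritical power -/
lemma interp {p q ε : ℝ} (hp : 2 < p) (hq : p < 2 * q) (hε : 0 < ε) :
    ∃ C, 0 ≤ C ∧ ∀ t : ℝ, |t| ^ p ≤ ε * (|t| ^ q) ^ 2 + C * t ^ 2 := by
  set T : ℝ := ε ^ (1 / (p - 2 * q)) with hT
  have hT0 : 0 < T := Real.rpow_pos_of_pos hε _
  refine ⟨T ^ (p - 2), by positivity, fun t => ?_⟩
  by_cases ht : t = 0
  · subst ht
    rw [abs_zero, Real.zero_rpow (by linarith)]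
    positivity
  have h1 : 0 < |t| := abs_pos.2 ht
  rcases le_total |t| T with hle | hle
  · have e : |t| ^ p = |t| ^ (p - 2) * t ^ 2 := by
      rw [← sq_abs t, ← Real.rpow_two, ← Real.rpow_add h1]; ring_nf
    have : |t| ^ (p - 2) ≤ T ^ (p - 2) := Real.rpow_le_rpow h1.le hle (by linarith)
    rw [e]
    have h3 : |t| ^ (p - 2) * t ^ 2 ≤ T ^ (p - 2) * t ^ 2 := by gcongr
    have : 0 ≤ ε * (|t| ^ q) ^ 2 := by positivity
    linarith
  · have e : |t| ^ p = |t| ^ (p - 2 * q) * (|t| ^ q) ^ 2 := by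
      rw [← abs_rpow_two_mul, ← Real.rpow_add h1]; ring_nf
    have h2 : |t| ^ (p - 2 * q) ≤ T ^ (p - 2 * q) :=
      Real.rpow_le_rpow_of_nonpos hT0 hle (by linarith)
    have h3 : T ^ (p - 2 * q) = ε := by
      rw [hT, ← Real.rpow_mul hε.le, one_div, inv_mul_cancel₀ (by linarith), Real.rpow_one]
    rw [h3] at h2
    rw [e]
    have h4 : |t| ^ (p - 2 * q) * (|t| ^ q) ^ 2 ≤ ε * (|t| ^ q) ^ 2 := by gcongr
    have : 0 ≤ T ^ (p - 2) * t ^ 2 := by positivity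
    linarith

lemma aux_uRad {u Rad X Sq : ℝ} (hRad : Rad ^ 2 ≤ X ^ 2 * Sq) : |u * Rad| ≤ u ^ 2 + X ^ 2 * Sq := by
  have h1 := two_mul_le_add_sq u Rad
  have h2 := two_mul_le_add_sq u (-Rad)
  have h3 := sq_nonneg u
  have h4 := sq_nonneg Rad
  rw [neg_sq] at h2
  rw [abs_le]; constructor <;> linarith

lemma aux_prod (a b : ℝ) : a * b ≤ a ^ 2 + b ^ 2 := by
  have h1 := two_mul_le_add_sq a b
  have h3 := sq_nonneg a
  have h4 := sq_nonneg b
  linarith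

lemma aux_k4 {m R : ℝ} (hm1 : m ≤ 1) (hR : 1 ≤ R) : 4 * m / R ^ 2 ≤ 4 := by
  have hR2 : 1 ≤ R ^ 2 := one_le_pow₀ hR
  rw [div_le_iff₀ (by positivity)]; linarith

lemma aux_kX {m R X : ℝ} (hm0 : 0 ≤ m) (hR : 1 ≤ R) (hmX : m * X ≤ m * R) :
    4 * m / R ^ 2 * X ≤ 4 * m := by
  have hR0 : 0 < R := by linarith
  rw [div_mul_eq_mul_div, div_le_iff₀ (by positivity)]
  have : m * R ≤ m * R ^ 2 := by
    apply mul_le_mul_of_nonneg_left _ hm0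
    rw [sq]; exact le_mul_of_one_le_left hR0.le hR
  linarith

lemma aux_kX2 {m R X : ℝ} (hm1 : m ≤ 1) (hR : 1 ≤ R) (hmX : m * X ^ 2 ≤ m * R ^ 2) :
    4 * m / R ^ 2 * X ^ 2 ≤ 4 := by
  have hR2 : 0 < R ^ 2 := by positivity
  rw [div_mul_eq_mul_div, div_le_iff₀ (by positivity)]
  have : m * R ^ 2 ≤ 1 * R ^ 2 := mul_le_mul_of_nonneg_right hm1 hR2.le
  linarith

lemma interp2 {p q : ℝ} (hp : 2 < p) (hq : p < 2 * q) (t : ℝ) :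
    |t| ^ p ≤ t ^ 2 + (|t| ^ q) ^ 2 := by
  rw [← abs_rpow_two_mul, ← sq_abs t, ← Real.rpow_two]
  rcases le_total |t| 1 with h1 | h1
  · have : |t| ^ p ≤ |t| ^ (2:ℝ) := by
      rcases (abs_nonneg t).eq_or_lt with h0 | h0
      · rw [← h0, Real.zero_rpow (by linarith), Real.zero_rpow (by norm_num)]
      · exact Real.rpow_le_rpow_of_exponent_ge h0 h1 hp.le
    have := Real.rpow_nonneg (abs_nonneg t) (2 * q)
    linarith
  · have : |t| ^ p ≤ |t| ^ (2 * q) := Real.rpow_le_rpow_of_exponent_le h1 hq.le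
    have := Real.rpow_nonneg (abs_nonneg t) (2:ℝ)
    linarith

set_option maxHeartbeats 2000000 in
lemma ineq1 {lam s mu q C1 m R X A a Sq Rad PL xL g u up : ℝ} (hs : s ^ 2 = lam) (hs0 : 0 ≤ s)
    (hq : 0 ≤ q) (hC1 : 0 ≤ C1) (hm0 : 0 ≤ m) (hm1 : m ≤ 1) (hR : 1 ≤ R) (hX : 0 ≤ X)
    (hmX : m * X ≤ m * R)
    (hA : 0 ≤ A) (ha : a = |u|) (hSq : 0 ≤ Sq) (hRad : Rad ^ 2 ≤ X ^ 2 * Sq) (hPL : PL ^ 2 ≤ Sq)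
    (hxL : |xL| ≤ X) (hg : |g| = A) (hup : |mu| * up ≤ lam / 4 * A ^ 2 + C1 * u ^ 2)
    (hup0 : 0 ≤ up) :
    lam / 4 * (m ^ 2 * A ^ 2) ≤ (C1 + (q + 1) ^ 2 + 30) * (Sq + X ^ 2 * Sq + u ^ 2) -
      (m ^ 2 * (Sq - lam * A ^ 2 - mu * up - u * Rad / 2 + s * ((q + 1) * g) * PL)
        - 4 * m / R ^ 2 * (u * Rad + s * (xL * (a * A)))) := by
  have hm2 : m ^ 2 ≤ 1 := pow_le_one₀ hm0 hm1
  have hm20 : 0 ≤ m ^ 2 := by positivity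
  have ha0 : 0 ≤ a := by rw [ha]; positivity
  have ha2 : a ^ 2 = u ^ 2 := by rw [ha, sq_abs]
  have hg2 : g ^ 2 = A ^ 2 := by rw [← hg, sq_abs]
  have hXS : 0 ≤ X ^ 2 * Sq := by positivity
  -- bracket
  have b1 : -(mu * up) ≤ lam / 4 * A ^ 2 + C1 * u ^ 2 := by
    refine le_trans ?_ hup
    have := mul_le_mul_of_nonneg_right (neg_abs_le mu) hup0
    linarith
  have b2 : -(u * Rad / 2) ≤ u ^ 2 + X ^ 2 * Sq := by
    have := (abs_le.1 (aux_uRad (u := u) hRad)).1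
    have := sq_nonneg u
    linarith
  have b3 : s * ((q + 1) * g) * PL ≤ lam / 4 * A ^ 2 + (q + 1) ^ 2 * Sq := by
    have h1 : s * ((q + 1) * g) * PL ≤ (s * g) ^ 2 / 4 + ((q + 1) * PL) ^ 2 := by
      have := sq_nonneg (s * g / 2 - (q + 1) * PL)
      linarith
    have h2 : (s * g) ^ 2 = lam * A ^ 2 := by rw [mul_pow, hs, hg2]
    have h3 : ((q + 1) * PL) ^ 2 ≤ (q + 1) ^ 2 * Sq := by rw [mul_pow]; gcongr
    linarith
  have b4 : Sq - lam * A ^ 2 - mu * up - u * Rad / 2 + s * ((q + 1) * g) * PL ≤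
      -(lam / 2) * A ^ 2 + (C1 + (q + 1) ^ 2 + 1) * (Sq + X ^ 2 * Sq + u ^ 2) := by
    have n1 : 0 ≤ C1 * Sq := by positivity
    have n2 : 0 ≤ C1 * (X ^ 2 * Sq) := by positivity
    have n3 : 0 ≤ (q + 1) ^ 2 * (X ^ 2 * Sq) := by positivity
    have n4 : 0 ≤ (q + 1) ^ 2 * u ^ 2 := by positivity
    linarith
  have b5 := mul_le_mul_of_nonneg_left b4 hm20
  have b6 : m ^ 2 * ((C1 + (q + 1) ^ 2 + 1) * (Sq + X ^ 2 * Sq + u ^ 2)) ≤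
      (C1 + (q + 1) ^ 2 + 1) * (Sq + X ^ 2 * Sq + u ^ 2) :=
    mul_le_of_le_one_left (by positivity) hm2
  -- cutoff terms
  have hR0 : 0 < R := by linarith
  have hk0 : 0 ≤ 4 * m / R ^ 2 := by positivity
  have hk4 : 4 * m / R ^ 2 ≤ 4 := aux_k4 hm1 hR
  have hkX : 4 * m / R ^ 2 * X ≤ 4 * m := aux_kX hm0 hR hmX
  generalize 4 * m / R ^ 2 = k at *
  have c1 : -(k * (u * Rad)) ≤ 4 * (u ^ 2 + X ^ 2 * Sq) := by
    have h1 : -(u * Rad) ≤ u ^ 2 + X ^ 2 * Sq := by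
      have := (abs_le.1 (aux_uRad (u := u) hRad)).1
      linarith
    have h2 : 0 ≤ u ^ 2 + X ^ 2 * Sq := by positivity
    have h3 := mul_le_mul_of_nonneg_left h1 hk0
    have h4 := mul_le_mul_of_nonneg_right hk4 h2
    linarith
  have c2 : -(k * (s * (xL * (a * A)))) ≤ lam / 4 * (m ^ 2 * A ^ 2) + 16 * u ^ 2 := by
    have h1 : -xL ≤ X := (neg_le_abs xL).trans hxL
    have h2 : -(k * (s * (xL * (a * A)))) ≤ k * X * (s * (a * A)) := by
      have : 0 ≤ k * (s * (a * A)) := by positivity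
      have h9 := mul_le_mul_of_nonneg_right h1 this
      linarith
    have h3 : k * X * (s * (a * A)) ≤ 4 * m * (s * (a * A)) := by gcongr
    have h4 : 4 * m * (s * (a * A)) ≤ (m * s * A) ^ 2 / 4 + 16 * a ^ 2 := by
      have := sq_nonneg (m * s * A / 2 - 4 * a)
      linarith
    have h5 : (m * s * A) ^ 2 = lam * (m ^ 2 * A ^ 2) := by rw [← hs]; ring
    rw [ha2, h5] at h4
    linarith
  have e1 : m ^ 2 * (-(lam / 2) * A ^ 2 + (C1 + (q + 1) ^ 2 + 1) * (Sq + X ^ 2 * Sq + u ^ 2))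
      = -(lam / 2) * (m ^ 2 * A ^ 2)
        + m ^ 2 * ((C1 + (q + 1) ^ 2 + 1) * (Sq + X ^ 2 * Sq + u ^ 2)) := by ring
  have hu2 : 0 ≤ u ^ 2 := sq_nonneg u
  linarith

set_option maxHeartbeats 2000000 in
lemma ineq2 {s K0 c CF n m R X A Sq Rad PL xL g hv Fv u up d1 : ℝ} (hs0 : 0 ≤ s)
    (hCF : 0 ≤ CF) (hn : 0 ≤ n) (hm0 : 0 ≤ m) (hm1 : m ≤ 1) (hR : 1 ≤ R) (hX : 0 ≤ X)
    (hmX : m * X ≤ m * R) (hmX2 : m * X ^ 2 ≤ m * R ^ 2)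
    (hA : 0 ≤ A) (hSq : 0 ≤ Sq) (hRad : Rad ^ 2 ≤ X ^ 2 * Sq) (hPL : PL ^ 2 ≤ Sq)
    (hxL : |xL| ≤ X) (hg : |g| = A) (hup : |up| ≤ u ^ 2 + A ^ 2) (hh : |hv| ≤ |u| * A)
    (hF : |Fv| ≤ CF * (u ^ 2 + A ^ 2)) :
    |m ^ 2 * (Rad ^ 2 / 2 - d1 * u ^ 2 - K0 * up) - 4 * m / R ^ 2 *
      (-Rad ^ 2 + X ^ 2 * Sq / 2 - X ^ 2 * Fv - c * (u * Rad + X ^ 2 * u ^ 2 / 4)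
        - s * (xL * (Rad * g + n * hv) - X ^ 2 * (g * PL)))| ≤
      (20 + |d1| + |K0| + 4 * CF + 8 * |c| + s * (16 + 4 * n)) * (Sq + X ^ 2 * Sq + u ^ 2 + A ^ 2) := by
  have hR0 : 0 < R := by linarith
  set k := 4 * m / R ^ 2 with hk
  have hk0 : 0 ≤ k := by positivity
  have hk4 : k ≤ 4 := aux_k4 hm1 hR
  have hkX2 : k * X ^ 2 ≤ 4 := aux_kX2 hm1 hR hmX2
  have hkX : k * X ≤ 4 := (aux_kX hm0 hR hmX).trans (by linarith)
  clear_value k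
  have hm2 : m ^ 2 ≤ 1 := pow_le_one₀ hm0 hm1
  have hm20 : 0 ≤ m ^ 2 := by positivity
  set ρ := √Sq with hρ
  have hρ0 : 0 ≤ ρ := Real.sqrt_nonneg _
  have hρ2 : ρ ^ 2 = Sq := Real.sq_sqrt hSq
  have hRad' : |Rad| ≤ X * ρ := by
    apply abs_le_of_sq_le_sq _ (by positivity)
    rw [mul_pow, hρ2]; exact hRad
  have hPL' : |PL| ≤ ρ := by
    apply abs_le_of_sq_le_sq _ (by positivity)
    rw [hρ2]; exact hPL
  have hXS : 0 ≤ X ^ 2 * Sq := by positivity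
  have hu2 : 0 ≤ u ^ 2 := sq_nonneg u
  have hA2 : 0 ≤ A ^ 2 := sq_nonneg A
  have t1 : |m ^ 2 * (Rad ^ 2 / 2)| ≤ X ^ 2 * Sq := by
    rw [abs_of_nonneg (by positivity)]; have h0 := mul_le_of_le_one_left (sq_nonneg Rad) hm2
    linarith
  have t2 : |m ^ 2 * (d1 * u ^ 2)| ≤ |d1| * u ^ 2 := by
    rw [abs_mul, abs_mul, abs_of_nonneg hm20, abs_of_nonneg hu2]
    exact mul_le_of_le_one_left (by positivity) hm2
  have t3 : |m ^ 2 * (K0 * up)| ≤ |K0| * (u ^ 2 + A ^ 2) := by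
    rw [abs_mul, abs_mul, abs_of_nonneg hm20]
    refine (mul_le_of_le_one_left (by positivity) hm2).trans ?_
    gcongr
  have t4 : |k * Rad ^ 2| ≤ 4 * (X ^ 2 * Sq) := by
    rw [abs_of_nonneg (by positivity)]; gcongr
  have t5 : |k * (X ^ 2 * Sq / 2)| ≤ 4 * (X ^ 2 * Sq) := by
    rw [abs_of_nonneg (by positivity)]; gcongr; linarith
  have t6 : |k * (X ^ 2 * Fv)| ≤ 4 * (CF * (u ^ 2 + A ^ 2)) := by
    rw [← mul_assoc, abs_mul, abs_of_nonneg (by positivity : 0 ≤ k * X ^ 2)]; gcongr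
  have t7 : |k * (c * (u * Rad))| ≤ 4 * (|c| * (u ^ 2 + X ^ 2 * Sq)) := by
    rw [abs_mul, abs_mul, abs_of_nonneg hk0]; gcongr
    exact aux_uRad hRad
  have t8 : |k * (c * (X ^ 2 * u ^ 2 / 4))| ≤ 4 * (|c| * u ^ 2) := by
    have : k * (c * (X ^ 2 * u ^ 2 / 4)) = (k * X ^ 2) * (c * (u ^ 2 / 4)) := by ring
    rw [this, abs_mul, abs_of_nonneg (by positivity : 0 ≤ k * X ^ 2), abs_mul,
      abs_of_nonneg (by positivity : 0 ≤ u ^ 2 / 4)]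
    gcongr; linarith
  have t9 : |k * (s * (xL * (Rad * g)))| ≤ 4 * (s * (Sq + A ^ 2)) := by
    rw [abs_mul, abs_mul, abs_mul, abs_mul, abs_of_nonneg hk0, abs_of_nonneg hs0, hg]
    calc k * (s * (|xL| * (|Rad| * A))) ≤ k * (s * (X * (X * ρ * A))) := by gcongr
      _ = (k * X ^ 2) * (s * (ρ * A)) := by ring
      _ ≤ 4 * (s * (Sq + A ^ 2)) := by
        gcongr
        rw [← hρ2]; exact aux_prod ρ A
  have t10 : |k * (s * (xL * (n * hv)))| ≤ 4 * (s * (n * (u ^ 2 + A ^ 2))) := by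
    rw [abs_mul, abs_mul, abs_mul, abs_mul, abs_of_nonneg hk0, abs_of_nonneg hs0, abs_of_nonneg hn]
    calc k * (s * (|xL| * (n * |hv|))) ≤ k * (s * (X * (n * (|u| * A)))) := by gcongr
      _ = (k * X) * (s * (n * (|u| * A))) := by ring
      _ ≤ 4 * (s * (n * (u ^ 2 + A ^ 2))) := by
        gcongr
        rw [← sq_abs u]; exact aux_prod |u| A
  have t11 : |k * (s * (X ^ 2 * (g * PL)))| ≤ 4 * (s * (Sq + A ^ 2)) := by
    rw [abs_mul, abs_mul, abs_mul, abs_mul, abs_of_nonneg hk0, abs_of_nonneg hs0, hg,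
      abs_of_nonneg (sq_nonneg X)]
    calc k * (s * (X ^ 2 * (A * |PL|))) ≤ k * (s * (X ^ 2 * (A * ρ))) := by gcongr
      _ = (k * X ^ 2) * (s * (ρ * A)) := by ring
      _ ≤ 4 * (s * (Sq + A ^ 2)) := by
        gcongr
        rw [← hρ2]; exact aux_prod ρ A
  have n1 : 0 ≤ |d1| * (Sq + X ^ 2 * Sq + A ^ 2) := by positivity
  have n2 : 0 ≤ |K0| * (Sq + X ^ 2 * Sq) := by positivity
  have n3 : 0 ≤ CF * (Sq + X ^ 2 * Sq) := by positivity
  have n4 : 0 ≤ |c| * Sq := by positivity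
  have n4' : 0 ≤ |c| * A ^ 2 := by positivity
  have n4'' : 0 ≤ |c| * (X ^ 2 * Sq) := by positivity
  have n5 : 0 ≤ s * (X ^ 2 * Sq + u ^ 2) := by positivity
  have n5' : 0 ≤ s * (Sq + A ^ 2) := by positivity
  have n6 : 0 ≤ s * (n * (Sq + X ^ 2 * Sq)) := by positivity
  rw [abs_le] at t1 t2 t3 t4 t5 t6 t7 t8 t9 t10 t11 ⊢
  constructor <;> linarith

lemma Y1_sum {N : ℕ} (L : Fin N) (s : ℝ) (u : Euc N → ℝ) (P : Fin N → Euc N → ℝ) (hh : ℝ → ℝ)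
    (x : Euc N) :
    ∑ i, x i * Y1 N L s u P hh i x = u x * (∑ j, x j * P j x) + s * (x L * hh (u x)) := by
  have h1 : ∀ i, x i * Y1 N L s u P hh i x
      = u x * (x i * P i x) + (if i = L then s * (x i * hh (u x)) else 0) := by
    intro i
    unfold Y1
    split_ifs <;> ring
  simp_rw [h1]
  rw [Finset.sum_add_distrib, ← Finset.mul_sum, Finset.sum_ite_eq' Finset.univ L]
  simp

lemma norm_sq_sum {N : ℕ} (x : Euc N) : ∑ i, (x i) ^ 2 = ‖x‖ ^ 2 := by
  rw [EuclideanSpace.norm_sq_eq]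
  simp

lemma Y2_sum {N : ℕ} (L : Fin N) (c s : ℝ) (u : Euc N → ℝ) (P : Fin N → Euc N → ℝ)
    (F g hh : ℝ → ℝ) (x : Euc N) :
    ∑ i, x i * Y2 N L c s u P F g hh i x =
      -(∑ j, x j * P j x) ^ 2 + ‖x‖ ^ 2 * (∑ j, (P j x) ^ 2) / 2 - ‖x‖ ^ 2 * F (u x)
      - c * (u x * (∑ j, x j * P j x) + ‖x‖ ^ 2 * (u x) ^ 2 / 4)
      - s * (x L * ((∑ j, x j * P j x) * g (u x) + ((N : ℝ) - 1) * hh (u x))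
        - ‖x‖ ^ 2 * (g (u x) * P L x)) := by
  set Rad := ∑ j, x j * P j x with hRad
  set Sq := ∑ j, (P j x) ^ 2 with hSq
  have h1 : ∀ i, x i * Y2 N L c s u P F g hh i x
      = (x i * P i x) * (-Rad - c * u x) + (x i) ^ 2 * (Sq / 2 - F (u x) - c * ((u x) ^ 2 / 4)
          + s * (g (u x) * P L x))
        + (if i = L then -(s * (x i * (Rad * g (u x) + ((N : ℝ) - 1) * hh (u x)))) else 0) := by
    intro i
    unfold Y2
    rw [← hRad, ← hSq]
    split_ifs <;> ring
  simp_rw [h1]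
  rw [Finset.sum_add_distrib, Finset.sum_add_distrib, ← Finset.sum_mul, ← Finset.sum_mul,
    Finset.sum_ite_eq' Finset.univ L, norm_sq_sum, ← hRad]
  simp only [Finset.mem_univ, if_true]
  ring

lemma Y1_C1 {N : ℕ} {S : Set (Euc N)} (L : Fin N) (s : ℝ) {u : Euc N → ℝ}
    {P : Fin N → Euc N → ℝ} {hh : ℝ → ℝ} (hu : ContDiffOn ℝ 1 u S)
    (hP : ∀ i, ContDiffOn ℝ 1 (P i) S) (hhh : ContDiff ℝ 1 hh) (i : Fin N) :
    ContDiffOn ℝ 1 (Y1 N L s u P hh i) S := by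
  have h3 : ContDiffOn ℝ 1 (fun y => hh (u y)) S := hhh.comp_contDiffOn hu
  have hPi := hP i
  unfold Y1
  fun_prop

lemma Y1_cont {N : ℕ} {S : Set (Euc N)} (L : Fin N) (s : ℝ) {u : Euc N → ℝ}
    {P : Fin N → Euc N → ℝ} {hh : ℝ → ℝ} (hu : ContinuousOn u S)
    (hP : ∀ i, ContinuousOn (P i) S) (hhh : Continuous hh) (i : Fin N) :
    ContinuousOn (Y1 N L s u P hh i) S := by
  have h3 : ContinuousOn (fun y => hh (u y)) S := hhh.comp_continuousOn hu
  have hPi := hP i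
  unfold Y1
  fun_prop

lemma Rad_cont {N : ℕ} {S : Set (Euc N)} 
    {P : Fin N → Euc N → ℝ} (hP : ∀ i, ContinuousOn (P i) S) :
    ContinuousOn (fun y : Euc N => ∑ j, y j * P j y) S := by
  refine continuousOn_finsetSum _ fun j _ => ?_
  have := hP j
  fun_prop

lemma Sq_cont {N : ℕ} {S : Set (Euc N)} 
    {P : Fin N → Euc N → ℝ} (hP : ∀ i, ContinuousOn (P i) S) :
    ContinuousOn (fun y : Euc N => ∑ j, (P j y) ^ 2) S :=
  continuousOn_finsetSum _ fun j _ => (hP j).pow 2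

lemma Y2_C1 {N : ℕ} {S : Set (Euc N)} (L : Fin N) (c s : ℝ) {u : Euc N → ℝ}
    {P : Fin N → Euc N → ℝ} {F g hh : ℝ → ℝ} (hu : ContDiffOn ℝ 1 u S)
    (hP : ∀ i, ContDiffOn ℝ 1 (P i) S) (hF : ContDiff ℝ 1 F) (hg : ContDiff ℝ 1 g)
    (hhh : ContDiff ℝ 1 hh) (i : Fin N) :
    ContDiffOn ℝ 1 (Y2 N L c s u P F g hh i) S := by
  have h1 : ContDiffOn ℝ 1 (fun y => F (u y)) S := hF.comp_contDiffOn hu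
  have h2 : ContDiffOn ℝ 1 (fun y => g (u y)) S := hg.comp_contDiffOn hu
  have h3 : ContDiffOn ℝ 1 (fun y => hh (u y)) S := hhh.comp_contDiffOn hu
  have hPi := hP i
  have hPL := hP L
  have h4 : ContDiffOn ℝ 1 (fun y : Euc N => ∑ j, y j * P j y) S := by
    refine ContDiffOn.sum fun j _ => ?_
    have := hP j
    fun_prop
  have h5 : ContDiffOn ℝ 1 (fun y : Euc N => ∑ j, (P j y) ^ 2) S :=
    ContDiffOn.sum fun j _ => (hP j).pow 2
  have h6 : ContDiffOn ℝ 1 (fun y : Euc N => (∑ j, (P j y) ^ 2) / 2) S := h5.div_const 2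
  have h7 : ContDiffOn ℝ 1 (fun y : Euc N => (u y) ^ 2 / 4) S := (hu.pow 2).div_const 4
  unfold Y2
  fun_prop

lemma Y2_cont {N : ℕ} {S : Set (Euc N)} (L : Fin N) (c s : ℝ) {u : Euc N → ℝ}
    {P : Fin N → Euc N → ℝ} {F g hh : ℝ → ℝ} (hu : ContinuousOn u S)
    (hP : ∀ i, ContinuousOn (P i) S) (hF : Continuous F) (hg : Continuous g)
    (hhh : Continuous hh) (i : Fin N) :
    ContinuousOn (Y2 N L c s u P F g hh i) S := by
  have h1 : ContinuousOn (fun y => F (u y)) S := hF.comp_continuousOn hu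
  have h2 : ContinuousOn (fun y => g (u y)) S := hg.comp_continuousOn hu
  have h3 : ContinuousOn (fun y => hh (u y)) S := hhh.comp_continuousOn hu
  have hPi := hP i
  have hPL := hP L
  have h4 := Rad_cont hP
  have h5 := Sq_cont hP
  unfold Y2
  fun_prop

lemma pd_PP {N : ℕ} {h : 0 < N} {u : Euc N → ℝ} (i j : Fin N) {x : Euc N}
    (hx : x ∈ upperHS N h) : pd (PP N h u j) i x = pd (pd u j) i x := by
  have : PP N h u j =ᶠ[𝓝 x] pd u j := by
    filter_upwards [(isOpen_upperHS N h).mem_nhds hx] with y hy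
    exact PP_eq u j hy
  rw [pd, this.fderiv_eq, ← pd]

lemma PP_symm {N : ℕ} {h : 0 < N} {u : Euc N → ℝ} (hu : ContDiffOn ℝ 2 u (upperHS N h))
    (i j : Fin N) {x : Euc N}
    (hx : x ∈ upperHS N h) : pd (PP N h u j) i x = pd (PP N h u i) j x := by
  have hc : ContDiffAt ℝ 2 u x := hu.contDiffAt ((isOpen_upperHS N h).mem_nhds hx)
  have hs := hc.isSymmSndFDerivAt (by simp)
  have hd : DifferentiableAt ℝ (fderiv ℝ u) x :=
    (hc.fderiv_right (m := 1) (by norm_num)).differentiableAt (by norm_num)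
  have key : ∀ k l : Fin N, pd (pd u k) l x
      = fderiv ℝ (fderiv ℝ u) x (EuclideanSpace.single l 1) (EuclideanSpace.single k 1) := by
    intro k l
    have : HasFDerivAt (pd u k) _ x := hd.hasFDerivAt.clm_apply (hasFDerivAt_const _ x)
    rw [pd, this.fderiv]
    simp
  rw [pd_PP i j hx, pd_PP j i hx, key, key]
  exact hs _ _

lemma lap_PP {N : ℕ} {h : 0 < N} {u : Euc N → ℝ} {x : Euc N}
    (hx : x ∈ upperHS N h) : ∑ i, pd (PP N h u i) i x = lap u x :=
  Finset.sum_congr rfl fun i _ => pd_PP i i hx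

lemma Rad_sq_le {N : ℕ} (x : Euc N) (P : Fin N → Euc N → ℝ) :
    (∑ j, x j * P j x) ^ 2 ≤ ‖x‖ ^ 2 * ∑ j, (P j x) ^ 2 := by
  rw [← norm_sq_sum]
  exact Finset.sum_mul_sq_le_sq_mul_sq _ _ _

lemma PL_sq_le {N : ℕ} (x : Euc N) (P : Fin N → Euc N → ℝ) (L : Fin N) :
    (P L x) ^ 2 ≤ ∑ j, (P j x) ^ 2 :=
  Finset.single_le_sum (f := fun j => (P j x) ^ 2) (fun j _ => sq_nonneg _) (Finset.mem_univ L)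

lemma abs_coord_le {N : ℕ} (x : Euc N) (L : Fin N) : |x L| ≤ ‖x‖ :=
  PiLp.norm_apply_le x L

lemma cutm_norm {N : ℕ} {R : ℝ} (hR : 0 < R) (x : Euc N) : cutm R x * ‖x‖ ≤ cutm R x * R := by
  rcases le_total R ‖x‖ with h | h
  · rw [cutm_zero hR x h]; simp
  · exact mul_le_mul_of_nonneg_left h (cutm_nonneg R x)

lemma cutm_norm_sq {N : ℕ} {R : ℝ} (hR : 0 < R) (x : Euc N) :
    cutm R x * ‖x‖ ^ 2 ≤ cutm R x * R ^ 2 := by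
  rcases le_total R ‖x‖ with h | h
  · rw [cutm_zero hR x h]; simp
  · refine mul_le_mul_of_nonneg_left ?_ (cutm_nonneg R x)
    gcongr

lemma cutm_half {N : ℕ} {R : ℝ} (hR : 0 < R) (x : Euc N) (hx : ‖x‖ ≤ R / 2) :
    1 / 2 ≤ cutm R x ^ 2 := by
  have h1 : 3 / 4 ≤ cutm R x := by
    refine le_trans ?_ (le_max_left _ _)
    have : ‖x‖ ^ 2 / R ^ 2 ≤ 1 / 4 := by
      rw [div_le_iff₀ (by positivity)]
      have : ‖x‖ ^ 2 ≤ (R / 2) ^ 2 := by gcongr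
      linarith
    linarith
  have : (3 / 4 : ℝ) ^ 2 ≤ cutm R x ^ 2 := by gcongr
  linarith

lemma cutm_tendsto {N : ℕ} (x : Euc N) :
    Tendsto (fun n : ℕ => cutm ((n : ℝ) + 1) x) atTop (𝓝 1) := by
  have h0 : Tendsto (fun n : ℕ => (n : ℝ) + 1) atTop atTop :=
    tendsto_atTop_add_const_right _ _ tendsto_natCast_atTop_atTop
  have h1 : Tendsto (fun n : ℕ => ‖x‖ ^ 2 / ((n : ℝ) + 1) ^ 2) atTop (𝓝 0) :=
    tendsto_const_nhds.div_atTop ((tendsto_pow_atTop (by norm_num)).comp h0)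
  have h2 := (tendsto_const_nhds (x := (1:ℝ))).sub h1
  have h3 := h2.max (tendsto_const_nhds (x := (0:ℝ)))
  simpa [cutm] using h3

lemma cutk_tendsto {N : ℕ} (x : Euc N) :
    Tendsto (fun n : ℕ => 4 * cutm ((n : ℝ) + 1) x / ((n : ℝ) + 1) ^ 2) atTop (𝓝 0) := by
  have h0 : Tendsto (fun n : ℕ => (n : ℝ) + 1) atTop atTop :=
    tendsto_atTop_add_const_right _ _ tendsto_natCast_atTop_atTop
  exact ((cutm_tendsto x).const_mul 4).div_atTop ((tendsto_pow_atTop (by norm_num)).comp h0)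

lemma integrable_of_cut (N : ℕ) (h : 0 < N) (f E : Euc N → ℝ) (G : ℕ → Euc N → ℝ)
    (hf : ContinuousOn f (upperHSc N h)) (hf0 : ∀ x, 0 ≤ f x)
    (hE : IntegrableOn E (upperHS N h))
    (hG : ∀ n, IntegrableOn (G n) (upperHS N h) ∧ ∫ x in upperHS N h, G n x = 0)
    (hle : ∀ n : ℕ, ∀ x ∈ upperHS N h, f x * cutm ((n : ℝ) + 1) x ^ 2 ≤ E x - G n x) :
    IntegrableOn f (upperHS N h) := by
  have hmeas : MeasurableSet (upperHS N h) := (isOpen_upperHS N h).measurableSet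
  have hr : Tendsto (fun n : ℕ => ((n : ℝ) + 1) / 2) atTop atTop :=
    (tendsto_atTop_add_const_right _ _ tendsto_natCast_atTop_atTop).atTop_div_const (by norm_num)
  have hcov : AECover (volume.restrict (upperHS N h)) atTop
      (fun n : ℕ => Metric.ball (0 : Euc N) (((n : ℝ) + 1) / 2)) := aecover_ball hr
  refine hcov.integrable_of_integral_bounded_of_nonneg_ae (2 * ∫ x in upperHS N h, E x) ?_
    (Eventually.of_forall hf0) (Eventually.of_forall ?_)
  · intro n
    rw [IntegrableOn, Measure.restrict_restrict Metric.isOpen_ball.measurableSet]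
    have hK : IsCompact (Metric.closedBall (0 : Euc N) (((n : ℝ) + 1) / 2) ∩ upperHSc N h) :=
      (isCompact_closedBall _ _).inter_right (isClosed_upperHSc N h)
    have : IntegrableOn f (Metric.closedBall (0 : Euc N) (((n : ℝ) + 1) / 2) ∩ upperHSc N h) :=
      (hf.mono inter_subset_right).integrableOn_compact hK
    exact this.mono_set (inter_subset_inter Metric.ball_subset_closedBall (upperHS_subset N h))
  · intro n
    have hI : IntegrableOn (fun x => 2 * (E x - G n x)) (upperHS N h) :=
      (hE.sub (hG n).1).const_mul 2
    have hpos : ∀ x ∈ upperHS N h, 0 ≤ 2 * (E x - G n x) := by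
      intro x hx
      have := hle n x hx
      have h1 : 0 ≤ f x * cutm ((n : ℝ) + 1) x ^ 2 := mul_nonneg (hf0 x) (sq_nonneg _)
      linarith
    have hn0 : (0:ℝ) < (n : ℝ) + 1 := by positivity
    rw [Measure.restrict_restrict Metric.isOpen_ball.measurableSet]
    calc ∫ x in Metric.ball (0 : Euc N) (((n : ℝ) + 1) / 2) ∩ upperHS N h, f x
        ≤ ∫ x in Metric.ball (0 : Euc N) (((n : ℝ) + 1) / 2) ∩ upperHS N h,
            2 * (E x - G n x) := by
          apply integral_mono_of_nonneg (Eventually.of_forall hf0) (hI.mono_set inter_subset_right)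
          refine (ae_restrict_iff' (Metric.isOpen_ball.measurableSet.inter hmeas)).2
            (Eventually.of_forall fun x hx => ?_)
          have h1 := hle n x hx.2
          have h2 : ‖x‖ ≤ ((n : ℝ) + 1) / 2 := (mem_ball_zero_iff.1 hx.1).le
          have h3 := mul_le_mul_of_nonneg_left (cutm_half hn0 x h2) (hf0 x)
          show f x ≤ _
          linarith
      _ ≤ ∫ x in upperHS N h, 2 * (E x - G n x) := by
          apply setIntegral_mono_set hI
          · exact (ae_restrict_iff' hmeas).2 (Eventually.of_forall hpos)
          · exact Eventually.of_forall fun x hx => hx.2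
      _ = 2 * ∫ x in upperHS N h, E x := by
          rw [integral_const_mul, integral_sub hE (hG n).1, (hG n).2, sub_zero]

lemma limit_zero (N : ℕ) (h : 0 < N) (D S B : Euc N → ℝ) (hB : IntegrableOn B (upperHS N h))
    (hG : ∀ R : ℝ, 0 < R → IntegrableOn
      (fun x => cutm R x ^ 2 * D x - (4 * cutm R x / R ^ 2) * S x) (upperHS N h) ∧
      ∫ x in upperHS N h, (cutm R x ^ 2 * D x - (4 * cutm R x / R ^ 2) * S x) = 0)
    (hb : ∀ R : ℝ, 1 ≤ R → ∀ x ∈ upperHS N h,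
      |cutm R x ^ 2 * D x - (4 * cutm R x / R ^ 2) * S x| ≤ B x) :
    ∫ x in upperHS N h, D x = 0 := by
  have hmeas : MeasurableSet (upperHS N h) := (isOpen_upperHS N h).measurableSet
  have hn : ∀ n : ℕ, (0:ℝ) < (n : ℝ) + 1 := fun n => by positivity
  have key := tendsto_integral_of_dominated_convergence (μ := volume.restrict (upperHS N h))
    (F := fun (n : ℕ) x => cutm ((n : ℝ) + 1) x ^ 2 * D x
      - (4 * cutm ((n : ℝ) + 1) x / ((n : ℝ) + 1) ^ 2) * S x) (f := D) B
    (fun n => (hG _ (hn n)).1.aestronglyMeasurable) hB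
    (fun n => (ae_restrict_iff' hmeas).2 (Eventually.of_forall fun x hx =>
      hb _ (by linarith [(Nat.cast_nonneg n : (0:ℝ) ≤ n)]) x hx))
    (Eventually.of_forall fun x => by
      have := (((cutm_tendsto x).pow 2).mul_const (D x)).sub ((cutk_tendsto x).mul_const (S x))
      simpa using this)
  have h2 : ∀ n : ℕ, ∫ x in upperHS N h, (cutm ((n : ℝ) + 1) x ^ 2 * D x
      - (4 * cutm ((n : ℝ) + 1) x / ((n : ℝ) + 1) ^ 2) * S x) = 0 := fun n => (hG _ (hn n)).2
  simp only [h2] at key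
  exact tendsto_nhds_unique key tendsto_const_nhds

lemma energy_int {N : ℕ} {h : 0 < N} {u : Euc N → ℝ} (hu : ContDiffOn ℝ 1 u (upperHSc N h))
    (hX : FiniteEnergy N h u) :
    IntegrableOn (fun x => (∑ j, (PP N h u j x) ^ 2) + ‖x‖ ^ 2 * (∑ j, (PP N h u j x) ^ 2)
      + (u x) ^ 2) (upperHS N h) := by
  have hmeas : MeasurableSet (upperHS N h) := (isOpen_upperHS N h).measurableSet
  have hc : ContinuousOn (fun x => (∑ j, (PP N h u j x) ^ 2)
      + ‖x‖ ^ 2 * (∑ j, (PP N h u j x) ^ 2) + (u x) ^ 2) (upperHSc N h) := by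
    have h1 := Sq_cont (fun i => PP_cont hu i)
    have h2 := hu.continuousOn
    fun_prop
  refine Integrable.mono' (hX.const_mul 5)
    ((hc.mono (upperHS_subset N h)).aestronglyMeasurable hmeas) ?_
  refine (ae_restrict_iff' hmeas).2 (Eventually.of_forall fun x hx => ?_)
  have e : ∑ j, (PP N h u j x) ^ 2 = gradSq u x :=
    Finset.sum_congr rfl fun j _ => by rw [PP_eq u j hx]
  have hg0 : 0 ≤ gradSq u x := Finset.sum_nonneg fun j _ => sq_nonneg _
  rw [e, Real.norm_of_nonneg (by positivity)]
  have hK : ‖x‖ ^ 2 / 4 + 1 ≤ Kw x := Real.add_one_le_exp _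
  have h1 : (‖x‖ ^ 2 / 4 + 1) * (gradSq u x + u x ^ 2) ≤ Kw x * (gradSq u x + u x ^ 2) := by
    gcongr
  have h2 : 0 ≤ ‖x‖ ^ 2 * u x ^ 2 := by positivity
  have h3 : 0 ≤ ‖x‖ ^ 2 * gradSq u x := by positivity
  have h4 := sq_nonneg (u x)
  linarith

lemma bdry_zero {N : ℕ} {h : 0 < N} {u : Euc N → ℝ} {q s c : ℝ} {F : ℝ → ℝ} (hq : 1 < q)
    (hc : ((N : ℝ) - 1) / (q + 1) = c)
    (hbc : ∀ x ∈ bdryHS N h, PP N h u (lastIdx N h) x = -(s * (|u x| ^ (q - 1) * u x)))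
    {x : Euc N} (hx : x ∈ bdryHS N h) :
    Y1 N (lastIdx N h) s u (PP N h u) (fun t => |t| ^ (q + 1)) (lastIdx N h) x = 0 ∧
    Y2 N (lastIdx N h) c s u (PP N h u) F (fun t => |t| ^ (q - 1) * t)
      (fun t => |t| ^ (q + 1) / (q + 1)) (lastIdx N h) x = 0 := by
  have h0 : x (lastIdx N h) = 0 := hx
  have h1 : |u x| ^ (q + 1) = |u x| ^ (q - 1) * u x * u x := by
    rw [abs_rpow_mul_mul (by linarith)]; ring_nf
  constructor
  · simp only [Y1, if_true]
    rw [hbc x hx, h1]; ring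
  · simp only [Y2, if_true]
    rw [h0, hbc x hx, h1]
    have : ((N : ℝ) - 1) * (|u x| ^ (q - 1) * u x * u x / (q + 1))
        = c * (|u x| ^ (q - 1) * u x * u x) := by rw [← hc]; ring
    rw [this]; ring

lemma div_Y1 {N : ℕ} {h : 0 < N} {u : Euc N → ℝ} {q s lam mu p : ℝ} (hq : 1 < q) (hp : 2 < p)
    (hu : ContDiffOn ℝ 2 u (upperHS N h))
    (hpde : ∀ x ∈ upperHS N h, -lap u x - (1 / 2) * radial u x
      = lam * |u x| ^ (2 * q - 2) * u x + mu * |u x| ^ (p - 2) * u x)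
    {x : Euc N} (hx : x ∈ upperHS N h) :
    ∑ i, pd (Y1 N (lastIdx N h) s u (PP N h u) (fun t => |t| ^ (q + 1)) i) i x =
      (∑ j, (PP N h u j x) ^ 2) - lam * (|u x| ^ q) ^ 2 - mu * |u x| ^ p
        - u x * (∑ j, x j * PP N h u j x) / 2
        + s * ((q + 1) * (|u x| ^ (q - 1) * u x)) * PP N h u (lastIdx N h) x := by
  have ho := (isOpen_upperHS N h).mem_nhds hx
  have hu1 : ContDiffOn ℝ 1 u (upperHS N h) := hu.of_le (by norm_num)
  have dd : ∀ f : Euc N → ℝ, ContDiffOn ℝ 1 f (upperHS N h) → DifferentiableAt ℝ f x :=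
    fun f hf => (hf.contDiffAt ho).differentiableAt (by norm_num)
  rw [Y1_div (lastIdx N h) s u (PP N h u) (fun t => |t| ^ (q + 1)) x
    ((q + 1) * |u x| ^ (q + 1 - 2) * u x) (dd _ hu1) (fun i => (PP_eq u i hx).symm)
    (fun i => dd _ (PP_C1 hu i)) (hasDerivAt_abs_rpow _ (by linarith))
    (fun i => dd _ (Y1_C1 _ s hu1 (PP_C1 hu) (absC1 (by linarith)) i)), lap_PP hx]
  have e1 : radial u x = ∑ j, x j * PP N h u j x :=
    Finset.sum_congr rfl fun j _ => by rw [PP_eq u j hx]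
  have e2 := hpde x hx
  rw [e1] at e2
  have e3 : |u x| ^ (2 * q - 2) * u x * u x = (|u x| ^ q) ^ 2 := by
    rw [abs_rpow_mul_mul (by linarith), ← abs_rpow_two_mul]; ring_nf
  have e4 : |u x| ^ (p - 2) * u x * u x = |u x| ^ p := by
    rw [abs_rpow_mul_mul (by linarith)]; ring_nf
  have e5 : q + 1 - 2 = q - 1 := by ring
  rw [e5, ← e3, ← e4]
  linear_combination (-u x) * e2

lemma div_Y2 {N : ℕ} {h : 0 < N} {u : Euc N → ℝ} {q s c lam mu p : ℝ} (hq : 1 < q) (hp : 2 < p)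
    (hc : c = ((N : ℝ) - 2) / 2) (hNq : (N : ℝ) / (2 * q) = c)
    (hu : ContDiffOn ℝ 2 u (upperHS N h))
    (hpde : ∀ x ∈ upperHS N h, -lap u x - (1 / 2) * radial u x
      = lam * |u x| ^ (2 * q - 2) * u x + mu * |u x| ^ (p - 2) * u x)
    {x : Euc N} (hx : x ∈ upperHS N h) :
    ∑ i, pd (Y2 N (lastIdx N h) c s u (PP N h u)
        (fun t => lam * |t| ^ (2 * q) / (2 * q) + mu * |t| ^ p / p)
        (fun t => |t| ^ (q - 1) * t) (fun t => |t| ^ (q + 1) / (q + 1)) i) i x =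
      (∑ j, x j * PP N h u j x) ^ 2 / 2 - c * N / 4 * (u x) ^ 2
        - mu * (N / p - c) * |u x| ^ p := by
  have ho := (isOpen_upperHS N h).mem_nhds hx
  have hu1 : ContDiffOn ℝ 1 u (upperHS N h) := hu.of_le (by norm_num)
  have dd : ∀ f : Euc N → ℝ, ContDiffOn ℝ 1 f (upperHS N h) → DifferentiableAt ℝ f x :=
    fun f hf => (hf.contDiffAt ho).differentiableAt (by norm_num)
  have hF : ∀ t : ℝ, HasDerivAt (fun t : ℝ => lam * |t| ^ (2 * q) / (2 * q) + mu * |t| ^ p / p)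
      (lam * |t| ^ (2 * q - 2) * t + mu * |t| ^ (p - 2) * t) t := by
    intro t
    have h1 := ((hasDerivAt_abs_rpow t (p := 2 * q) (by linarith)).const_mul lam).div_const (2 * q)
    have h2 := ((hasDerivAt_abs_rpow t (p := p) (by linarith)).const_mul mu).div_const p
    refine (h1.add h2).congr_deriv ?_
    have hq0 : q ≠ 0 := by linarith
    have hp0 : p ≠ 0 := by linarith
    field_simp
  have hH : HasDerivAt (fun t : ℝ => |t| ^ (q + 1) / (q + 1)) (|u x| ^ (q - 1) * u x) (u x) := by
    refine ((hasDerivAt_abs_rpow (u x) (p := q + 1) (by linarith)).div_const (q + 1)).congr_deriv ?_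
    have e5 : q + 1 - 2 = q - 1 := by ring
    have : q + 1 ≠ 0 := by linarith
    rw [e5]; field_simp
  have hFC : ContDiff ℝ 1 (fun t : ℝ => lam * |t| ^ (2 * q) / (2 * q) + mu * |t| ^ p / p) :=
    ((contDiff_const.mul (absC1 (by linarith))).div_const _).add
      ((contDiff_const.mul (absC1 hp)).div_const _)
  rw [Y2_div (lastIdx N h) c s hc u (PP N h u) _ (fun t => |t| ^ (q - 1) * t)
    (fun t => |t| ^ (q + 1) / (q + 1)) x _ _ (dd _ hu1) (fun i => (PP_eq u i hx).symm)
    (fun i => dd _ (PP_C1 hu i)) (fun i j => PP_symm hu i j hx) (hF (u x))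
    (gder (r := q - 1) (by linarith) (u x)) hH
    (fun i => dd _ (Y2_C1 _ c s hu1 (PP_C1 hu) hFC (gC1 (by linarith))
      ((absC1 (by linarith)).div_const _) i)), lap_PP hx]
  have e1 : radial u x = ∑ j, x j * PP N h u j x :=
    Finset.sum_congr rfl fun j _ => by rw [PP_eq u j hx]
  have e2 := hpde x hx
  rw [e1] at e2
  have e3 : |u x| ^ (2 * q - 2) * u x * u x = |u x| ^ (2 * q) := by
    rw [abs_rpow_mul_mul (by linarith)]; ring_nf
  have e4 : |u x| ^ (p - 2) * u x * u x = |u x| ^ p := by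
    rw [abs_rpow_mul_mul (by linarith)]; ring_nf
  have e6 : (N : ℝ) * (lam * |u x| ^ (2 * q) / (2 * q) + mu * |u x| ^ p / p)
      = c * (lam * |u x| ^ (2 * q)) + mu * (N / p) * |u x| ^ p := by rw [← hNq]; ring
  simp only [e6]
  rw [← e3, ← e4]
  linear_combination (∑ j, x j * PP N h u j x + c * u x) * e2

lemma A2_int {N : ℕ} {h : 0 < N} {u : Euc N → ℝ} {q c lam mu p : ℝ} (hlam : 0 < lam)
    (hq : 1 < q) (hp : 2 < p) (hpq : p < 2 * q)
    (hc : ((N : ℝ) - 1) / (q + 1) = c)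
    (hu : ContDiffOn ℝ 2 u (upperHS N h)) (hu1 : ContDiffOn ℝ 1 u (upperHSc N h))
    (hpde : ∀ x ∈ upperHS N h, -lap u x - (1 / 2) * radial u x
      = lam * |u x| ^ (2 * q - 2) * u x + mu * |u x| ^ (p - 2) * u x)
    (hbc : ∀ x ∈ bdryHS N h, PP N h u (lastIdx N h) x = -(√lam * (|u x| ^ (q - 1) * u x)))
    (hX : FiniteEnergy N h u) :
    IntegrableOn (fun x => (|u x| ^ q) ^ 2) (upperHS N h) := by
  set s := √lam with hs
  have hs0 : 0 ≤ s := Real.sqrt_nonneg _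
  have hs2 : s ^ 2 = lam := Real.sq_sqrt hlam.le
  have huc : ContinuousOn u (upperHSc N h) := hu1.continuousOn
  have hPc : ∀ i, ContinuousOn (PP N h u i) (upperHSc N h) := PP_cont hu1
  obtain ⟨C0, hC0, hItp⟩ := interp hp hpq (ε := lam / (4 * (|mu| + 1))) (by positivity)
  have hup : ∀ t : ℝ, |mu| * |t| ^ p ≤ lam / 4 * (|t| ^ q) ^ 2 + (|mu| * C0) * t ^ 2 := by
    intro t
    have h1 := mul_le_mul_of_nonneg_left (hItp t) (abs_nonneg mu)
    have h2 : |mu| * (lam / (4 * (|mu| + 1))) ≤ lam / 4 := by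
      rw [mul_div_assoc', div_le_iff₀ (by positivity)]
      have := abs_nonneg mu
      linarith
    have h3 := mul_le_mul_of_nonneg_right h2 (sq_nonneg (|t| ^ q))
    linarith
  have hA : ContinuousOn (fun x => |u x| ^ q) (upperHSc N h) :=
    (cont_abs_rpow (by linarith)).comp_continuousOn huc
  have hap : ContinuousOn (fun x => |u x| ^ p) (upperHSc N h) :=
    (cont_abs_rpow (by linarith)).comp_continuousOn huc
  have hg : ContinuousOn (fun x => |u x| ^ (q - 1)) (upperHSc N h) :=
    (cont_abs_rpow (by linarith)).comp_continuousOn huc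
  have hRc := Rad_cont hPc
  have hSc := Sq_cont hPc
  have hPL := hPc (lastIdx N h)
  have key := divHS_cut N h (Y1 N (lastIdx N h) s u (PP N h u) (fun t => |t| ^ (q + 1)))
    (fun i => Y1_C1 _ s (hu.of_le (by norm_num)) (PP_C1 hu) (absC1 (by linarith)) i)
    (fun i => Y1_cont _ s huc hPc (cont_abs_rpow (by linarith)) i)
    (fun x hx => (bdry_zero (F := fun t => t) hq hc hbc hx).1) _
    (by fun_prop) (fun x hx => div_Y1 hq hp hu hpde hx)
  have hn : ∀ n : ℕ, (0:ℝ) < (n : ℝ) + 1 := fun n => by positivity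
  have hE := energy_int hu1 hX
  refine integrable_of_cut N h _ _ (fun n x => (4 / lam) * _) (hA.pow 2) (fun x => sq_nonneg _)
    (hE.const_mul (4 / lam * ((|mu| * C0) + (q + 1) ^ 2 + 30)))
    (fun n => ⟨(key _ (hn n)).1.const_mul (4 / lam), by
      rw [integral_const_mul, (key _ (hn n)).2, mul_zero]⟩) ?_
  intro n x hx
  have h1 := ineq1 (lam := lam) (s := s) (mu := mu) (q := q) (C1 := |mu| * C0)
    (m := cutm ((n : ℝ) + 1) x) (R := (n : ℝ) + 1) (X := ‖x‖) (A := |u x| ^ q) (a := |u x|)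
    (Sq := ∑ j, (PP N h u j x) ^ 2) (Rad := ∑ j, x j * PP N h u j x)
    (PL := PP N h u (lastIdx N h) x) (xL := x (lastIdx N h)) (g := |u x| ^ (q - 1) * u x)
    (u := u x) (up := |u x| ^ p) hs2 hs0 (by linarith) (by positivity) (cutm_nonneg _ _)
    (cutm_le_one _ _) (by linarith [(Nat.cast_nonneg n : (0:ℝ) ≤ n)]) (norm_nonneg _)
    (cutm_norm (hn n) x) (by positivity) rfl (Finset.sum_nonneg fun j _ => sq_nonneg _)
    (Rad_sq_le _ _) (PL_sq_le _ _ _) (abs_coord_le _ _) (abs_rpow_sub_mul (by linarith) _)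
    (hup _) (by positivity)
  have h2 := mul_le_mul_of_nonneg_left h1 (by positivity : 0 ≤ 4 / lam)
  rw [Y1_sum, abs_rpow_add_one (by linarith)]
  have h3 : 4 / lam * (lam / 4 * (cutm ((n : ℝ) + 1) x ^ 2 * (|u x| ^ q) ^ 2))
      = (|u x| ^ q) ^ 2 * cutm ((n : ℝ) + 1) x ^ 2 := by field_simp
  rw [h3] at h2
  linarith

lemma D2_zero {N : ℕ} {h : 0 < N} {u : Euc N → ℝ} {q c lam mu p : ℝ} (hlam : 0 < lam)
    (hq : 1 < q) (hp : 2 < p) (hpq : p < 2 * q)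
    (hc : ((N : ℝ) - 1) / (q + 1) = c) (hc2 : c = ((N : ℝ) - 2) / 2) (hNq : (N : ℝ) / (2 * q) = c)
    (hu : ContDiffOn ℝ 2 u (upperHS N h)) (hu1 : ContDiffOn ℝ 1 u (upperHSc N h))
    (hpde : ∀ x ∈ upperHS N h, -lap u x - (1 / 2) * radial u x
      = lam * |u x| ^ (2 * q - 2) * u x + mu * |u x| ^ (p - 2) * u x)
    (hbc : ∀ x ∈ bdryHS N h, PP N h u (lastIdx N h) x = -(√lam * (|u x| ^ (q - 1) * u x)))
    (hX : FiniteEnergy N h u) (hA2 : IntegrableOn (fun x => (|u x| ^ q) ^ 2) (upperHS N h)) :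
    ∫ x in upperHS N h, ((∑ j, x j * PP N h u j x) ^ 2 / 2 - c * N / 4 * (u x) ^ 2
        - mu * (N / p - c) * |u x| ^ p) = 0 := by
  set s := √lam with hs
  have hs0 : 0 ≤ s := Real.sqrt_nonneg _
  have huc : ContinuousOn u (upperHSc N h) := hu1.continuousOn
  have hPc : ∀ i, ContinuousOn (PP N h u i) (upperHSc N h) := PP_cont hu1
  have hap : ContinuousOn (fun x => |u x| ^ p) (upperHSc N h) :=
    (cont_abs_rpow (by linarith)).comp_continuousOn huc
  have hRc := Rad_cont hPc
  have hFC : ContDiff ℝ 1 (fun t : ℝ => lam * |t| ^ (2 * q) / (2 * q) + mu * |t| ^ p / p) :=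
    ((contDiff_const.mul (absC1 (by linarith))).div_const _).add
      ((contDiff_const.mul (absC1 hp)).div_const _)
  have hgC : ContDiff ℝ 1 (fun t : ℝ => |t| ^ (q - 1) * t) := gC1 (by linarith)
  have hhC : ContDiff ℝ 1 (fun t : ℝ => |t| ^ (q + 1) / (q + 1)) :=
    (absC1 (by linarith)).div_const _
  have key := divHS_cut N h (Y2 N (lastIdx N h) c s u (PP N h u)
        (fun t => lam * |t| ^ (2 * q) / (2 * q) + mu * |t| ^ p / p)
        (fun t => |t| ^ (q - 1) * t) (fun t => |t| ^ (q + 1) / (q + 1)))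
    (fun i => Y2_C1 _ c s (hu.of_le (by norm_num)) (PP_C1 hu) hFC hgC hhC i)
    (fun i => Y2_cont _ c s huc hPc hFC.continuous hgC.continuous hhC.continuous i)
    (fun x hx => (bdry_zero hq hc hbc hx).2)
    (fun x => (∑ j, x j * PP N h u j x) ^ 2 / 2 - c * N / 4 * (u x) ^ 2
        - mu * (N / p - c) * |u x| ^ p)
    (by fun_prop) (fun x hx => div_Y2 hq hp hc2 hNq hu hpde hx)
  have hE := energy_int hu1 hX
  have hN1 : (0:ℝ) ≤ (N : ℝ) - 1 := by
    have : (1:ℝ) ≤ N := by exact_mod_cast h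
    linarith
  refine limit_zero N h _ _ _ ((hE.add hA2).const_mul (20 + |c * N / 4| + |mu * (N / p - c)|
    + 4 * (lam + |mu|) + 8 * |c| + s * (16 + 4 * ((N : ℝ) - 1)))) key ?_
  intro R hR x hx
  have hR0 : 0 < R := by linarith
  have hup : |u x| ^ p ≤ u x ^ 2 + (|u x| ^ q) ^ 2 := interp2 hp hpq (u x)
  have hup0 : 0 ≤ |u x| ^ p := by positivity
  have hF : |lam * |u x| ^ (2 * q) / (2 * q) + mu * |u x| ^ p / p|
      ≤ (lam + |mu|) * (u x ^ 2 + (|u x| ^ q) ^ 2) := by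
    refine (abs_add_le _ _).trans ?_
    rw [abs_rpow_two_mul, abs_of_nonneg (by positivity), abs_div, abs_mul, abs_of_nonneg hup0,
      abs_of_pos (by linarith : 0 < p)]
    have h1 : lam * (|u x| ^ q) ^ 2 / (2 * q) ≤ lam * (|u x| ^ q) ^ 2 :=
      div_le_self (by positivity) (by linarith)
    have h2 : |mu| * |u x| ^ p / p ≤ |mu| * |u x| ^ p :=
      div_le_self (by positivity) (by linarith)
    have h3 := mul_le_mul_of_nonneg_left hup (abs_nonneg mu)
    have h4 : 0 ≤ lam * u x ^ 2 := by positivity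
    linarith
  have hh : abs (|u x| ^ (q + 1) / (q + 1)) ≤ |u x| * |u x| ^ q := by
    rw [abs_of_nonneg (by positivity), ← abs_rpow_add_one (by linarith)]
    exact div_le_self (by positivity) (by linarith)
  have h1 := ineq2 (s := s) (K0 := mu * (N / p - c)) (c := c) (CF := lam + |mu|)
    (n := (N : ℝ) - 1)
    (m := cutm R x) (R := R) (X := ‖x‖) (A := |u x| ^ q)
    (Sq := ∑ j, (PP N h u j x) ^ 2) (Rad := ∑ j, x j * PP N h u j x)
    (PL := PP N h u (lastIdx N h) x) (xL := x (lastIdx N h)) (g := |u x| ^ (q - 1) * u x)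
    (hv := |u x| ^ (q + 1) / (q + 1)) (Fv := lam * |u x| ^ (2 * q) / (2 * q) + mu * |u x| ^ p / p)
    (u := u x) (up := |u x| ^ p) (d1 := c * N / 4) hs0 (by positivity) hN1 (cutm_nonneg _ _)
    (cutm_le_one _ _) hR (norm_nonneg _)
    (cutm_norm hR0 x) (cutm_norm_sq hR0 x) (by positivity)
    (Finset.sum_nonneg fun j _ => sq_nonneg _)
    (Rad_sq_le _ _) (PL_sq_le _ _ _) (abs_coord_le _ _) (abs_rpow_sub_mul (by linarith) _)
    (by rw [abs_of_nonneg hup0]; exact hup) hh hF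
  rw [Y2_sum]
  exact h1

end

/-- combined Pohozaev identity for problem (1.1). -/
theorem statement8 (N : ℕ) (hN : 3 ≤ N) (lam mu p : ℝ)
    (hlam : 0 < lam) (hp1 : 2 < p) (hp2 : p < twoStar N)
    (u : Euc N → ℝ)
    (hu : IsClassicalSolution N (by omega) lam mu p u)
    (hX : FiniteEnergy N (by omega) u) :
    mu * ((N : ℝ) / p - ((N : ℝ) - 2) / 2)
        * (∫ x in upperHS N (by omega : 0 < N), |u x| ^ p)
      = (1 / 2) * (∫ x in upperHS N (by omega : 0 < N), (radial u x) ^ 2)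
        - ((N : ℝ) * ((N : ℝ) - 2) / 8)
            * ∫ x in upperHS N (by omega : 0 < N), (u x) ^ 2 := by
  have h : 0 < N := by omega
  have hN' : (3:ℝ) ≤ N := by exact_mod_cast hN
  have hN2 : (0:ℝ) < (N : ℝ) - 2 := by linarith
  have hN2' : (N : ℝ) - 2 ≠ 0 := hN2.ne'
  obtain ⟨q, hqdef⟩ : ∃ q : ℝ, q = N / ((N : ℝ) - 2) := ⟨_, rfl⟩
  obtain ⟨c, hc2⟩ : ∃ c : ℝ, c = ((N : ℝ) - 2) / 2 := ⟨_, rfl⟩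
  have hq : 1 < q := by rw [hqdef, lt_div_iff₀ hN2]; linarith
  have e1 : twoStar N = 2 * q := by rw [twoStar, hqdef]; ring
  have e2 : twoStarL N - 2 = q - 1 := by rw [twoStarL, hqdef]; field_simp; ring
  rw [e1] at hp2
  have hN0 : (N : ℝ) ≠ 0 := by linarith
  have hNq : (N : ℝ) / (2 * q) = c := by rw [hqdef, hc2]; field_simp
  have hc : ((N : ℝ) - 1) / (q + 1) = c := by
    rw [div_eq_iff (by linarith), hqdef, hc2]; field_simp; ring
  obtain ⟨hu2, hu1, hpde, hbc0⟩ := hu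
  rw [e1] at hpde
  have hbc : ∀ x ∈ bdryHS N h,
      PP N h u (lastIdx N h) x = -(√lam * (|u x| ^ (q - 1) * u x)) := by
    intro x hx
    have h1 := hbc0 x hx
    rw [e2] at h1
    have h2 : PP N h u (lastIdx N h) x = pdN N h u x := rfl
    rw [h2]; linarith
  have hA2 := A2_int hlam hq hp1 hp2 hc hu2 hu1 hpde hbc hX
  have hD := D2_zero hlam hq hp1 hp2 hc hc2 hNq hu2 hu1 hpde hbc hX hA2
  have hE := energy_int hu1 hX
  have hmeas : MeasurableSet (upperHS N h) := (isOpen_upperHS N h).measurableSet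
  have huc : ContinuousOn u (upperHSc N h) := hu1.continuousOn
  have hap : ContinuousOn (fun x => |u x| ^ p) (upperHSc N h) :=
    (cont_abs_rpow (by linarith)).comp_continuousOn huc
  have hRc := Rad_cont (PP_cont hu1)
  have iU : IntegrableOn (fun x => (u x) ^ 2) (upperHS N h) := by
    refine Integrable.mono' hE
      (((huc.pow 2).mono (upperHS_subset N h)).aestronglyMeasurable hmeas)
      (Eventually.of_forall fun x => ?_)
    rw [Real.norm_of_nonneg (sq_nonneg _)]
    have h1 : 0 ≤ ∑ j, (PP N h u j x) ^ 2 := Finset.sum_nonneg fun j _ => sq_nonneg _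
    have h2 := mul_nonneg (sq_nonneg ‖x‖) h1
    linarith
  have iR : IntegrableOn (fun x : Euc N => (∑ j, x j * PP N h u j x) ^ 2) (upperHS N h) := by
    refine Integrable.mono' hE
      (((hRc.pow 2).mono (upperHS_subset N h)).aestronglyMeasurable hmeas)
      (Eventually.of_forall fun x => ?_)
    rw [Real.norm_of_nonneg (sq_nonneg _)]
    have h1 : 0 ≤ ∑ j, (PP N h u j x) ^ 2 := Finset.sum_nonneg fun j _ => sq_nonneg _
    have h2 := Rad_sq_le x (PP N h u)
    have h3 := sq_nonneg (u x)
    linarith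
  have iP : IntegrableOn (fun x => |u x| ^ p) (upperHS N h) := by
    refine Integrable.mono' (iU.add hA2)
      ((hap.mono (upperHS_subset N h)).aestronglyMeasurable hmeas)
      (Eventually.of_forall fun x => ?_)
    rw [Real.norm_of_nonneg (by positivity)]
    exact interp2 hp1 hp2 (u x)
  have hrad : ∫ x in upperHS N h, (radial u x) ^ 2
      = ∫ x in upperHS N h, (∑ j, x j * PP N h u j x) ^ 2 := by
    refine setIntegral_congr_fun hmeas fun x hx => ?_
    have : radial u x = ∑ j, x j * PP N h u j x :=
      Finset.sum_congr rfl fun j _ => by rw [PP_eq u j hx]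
    simp only [this]
  have i1 : Integrable (fun x : Euc N => (∑ j, x j * PP N h u j x) ^ 2 / 2 - c * N / 4 * (u x) ^ 2)
      (volume.restrict (upperHS N h)) := (iR.div_const 2).sub (iU.const_mul _)
  rw [integral_sub i1 (iP.const_mul _),
    integral_sub (iR.div_const 2) (iU.const_mul _), integral_div, integral_const_mul,
    integral_const_mul] at hD
  rw [hrad, ← hc2]
  have : (N : ℝ) * ((N : ℝ) - 2) / 8 = c * N / 4 := by rw [hc2]; ring
  rw [this]
  linarith
end
end

section
/- Let N ≥ 3. For every ε > 0, the three integrals K₁(ε) := ∫_{ℝ^N_+} |∇U_ε|² dx, K₂(ε) := ∫_{ℝ^N_+} U_ε^{2*} dx and K₃(ε) := ∫_{ℝ^{N-1}} U_ε(x',0)^{2_*} dx' are finite, are independent of ε, and satisfy K₁(ε) = K₂(ε) + K₃(ε). -/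
open MeasureTheory Real Topology Filter

noncomputable section

lemma Ubub_def (m : ℕ) (ε : ℝ) (x : Euc (m+1)) :
    ε ^ 2 + horizSq (Nat.succ_pos m) x + (x (lastIdx (m+1) (Nat.succ_pos m)) + ε * 1 * xN0 (m+1)) ^ 2
     = ε^2 + ‖x + EuclideanSpace.single (Fin.last m) (ε * xN0 (m+1))‖^2 := by
  have e : lastIdx (m+1) (Nat.succ_pos m) = Fin.last m := rfl
  rw [EuclideanSpace.real_norm_sq_eq, horizSq, e, ← Finset.add_sum_erase _ _ (Finset.mem_univ (Fin.last m))]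
  have : ∑ i ∈ Finset.univ.erase (Fin.last m), (x + EuclideanSpace.single (Fin.last m) (ε * xN0 (m+1))) i ^ 2 = ∑ i ∈ Finset.univ.erase (Fin.last m), x i ^ 2 := by
    refine Finset.sum_congr rfl fun i hi => ?_
    simp [Finset.ne_of_mem_erase hi]
  rw [this]
  simp
  ring

lemma int_pow (E : Type*) [NormedAddCommGroup E] [InnerProductSpace ℝ E] [FiniteDimensional ℝ E] [MeasurableSpace E] [BorelSpace E]
   (p : ℕ) (hp : Module.finrank ℝ E < 2 * p) (δ : ℝ) (hδ : 0 < δ):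
    Integrable (fun x : E => ((δ + ‖x‖^2)^p)⁻¹) := by
  have h := (integrable_rpow_neg_one_add_norm_sq (E := E) (μ := volume) (r := 2 * p) (by exact_mod_cast hp)).const_mul (((min 1 δ)^p)⁻¹)
  refine h.mono' (Measurable.aestronglyMeasurable (by fun_prop)) (Eventually.of_forall fun x => ?_)
  have h0 : 0 < min 1 δ := by positivity
  rw [Real.norm_of_nonneg (by positivity), show (-(2 * (p:ℝ)) / 2) = -(p:ℝ) by ring, Real.rpow_neg (by positivity), Real.rpow_natCast, ← mul_inv, ← mul_pow]
  gcongr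
  have h1 := min_le_left 1 δ
  have h2 := min_le_right 1 δ
  nlinarith [sq_nonneg ‖x‖]

lemma scale_int (m p : ℕ) (A : ℝ) (hA : 0 < A) (hp : m ≤ 2 * p) :
    ∫ y : Euc m, ((A^2 + ‖y‖^2)^p)⁻¹ = (A^(2*p-m))⁻¹ * ∫ y : Euc m, ((1 + ‖y‖^2)^p)⁻¹ := by
  have h := Measure.integral_comp_smul (volume : Measure (Euc m)) (fun y => ((A^2 + ‖y‖^2)^p)⁻¹) A
  have e : ∀ y : Euc m, ((A^2 + ‖A • y‖^2)^p)⁻¹ = (A^(2*p))⁻¹ * ((1 + ‖y‖^2)^p)⁻¹ := by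
    intro y
    rw [norm_smul, Real.norm_of_nonneg hA.le, ← mul_inv, pow_mul, ← mul_pow]
    congr 2; ring
  simp only [e] at h
  rw [integral_const_mul, finrank_euclideanSpace_fin, abs_of_pos (by positivity), smul_eq_mul] at h
  have : A^(2*p) = A^(2*p-m) * A^m := by rw [← pow_add]; congr 1; omega
  rw [this] at h
  field_simp at h ⊢
  linarith

lemma half_int (m : ℕ) (hm : 0 < m) :
    ∫ y : Euc m, ((1 + ‖y‖^2)^(m+1))⁻¹ = (1/2) * ∫ y : Euc m, ((1 + ‖y‖^2)^m)⁻¹ := by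
  have i1 := int_pow (Euc m) m (by simp; omega) 1 one_pos
  have i2 := int_pow (Euc m) (m+1) (by simp; omega) 1 one_pos
  have key : ∫ y : Euc m, (2 * ((1 + ‖y‖^2)^(m+1))⁻¹ - ((1 + ‖y‖^2)^m)⁻¹) = 0 := by
    have : Nontrivial (Euc m) := by
      have : Nonempty (Fin m) := ⟨⟨0, hm⟩⟩
      infer_instance
    have hi := (i2.const_mul 2).sub i1
    have hi' := (integrable_fun_norm_addHaar (volume : Measure (Euc m)) (f := fun r : ℝ => 2 * ((1 + r^2)^(m+1))⁻¹ - ((1 + r^2)^m)⁻¹)).1 hi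
    rw [integral_fun_norm_addHaar (volume : Measure (Euc m)) (fun r : ℝ => 2 * ((1 + r^2)^(m+1))⁻¹ - ((1 + r^2)^m)⁻¹)]
    rw [finrank_euclideanSpace_fin] at hi' ⊢
    have d : ∀ r ∈ Set.Ici (0:ℝ), HasDerivAt (fun r : ℝ => (1/(m:ℝ)) * (r / (1+r^2))^m) (r^(m-1) • (2 * ((1 + r^2)^(m+1))⁻¹ - ((1 + r^2)^m)⁻¹)) r := by
      intro r _
      have h1 : HasDerivAt (fun r : ℝ => 1 + r^2) (2*r) r := by
        simpa using ((hasDerivAt_id r).pow 2).const_add 1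
      have h2 := (((hasDerivAt_id r).fun_div h1 (by positivity)).fun_pow m).const_mul (1/(m:ℝ))
      refine h2.congr_deriv ?_
      obtain ⟨k, rfl⟩ : ∃ k, m = k+1 := ⟨m-1, by omega⟩
      have : (1:ℝ)+r^2 ≠ 0 := by positivity
      simp only [id, Nat.add_sub_cancel, smul_eq_mul, div_pow]
      field_simp
      ring
    have t : Tendsto (fun r : ℝ => (1/(m:ℝ)) * (r / (1+r^2))^m) atTop (𝓝 0) := by
      have : Tendsto (fun r : ℝ => r / (1+r^2)) atTop (𝓝 0) := by
        refine tendsto_of_tendsto_of_tendsto_of_le_of_le' tendsto_const_nhds tendsto_inv_atTop_zero ?_ ?_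
        · filter_upwards [eventually_gt_atTop 0] with r hr
          positivity
        · filter_upwards [eventually_gt_atTop 0] with r hr
          field_simp
          nlinarith
      simpa [hm.ne'] using (this.pow m).const_mul (1/(m:ℝ))
    rw [integral_Ioi_of_hasDerivAt_of_tendsto' d hi' t]
    simp [hm.ne']
  rw [integral_sub (i2.const_mul 2) i1, integral_const_mul] at key
  linarith

lemma norm_emb (m : ℕ) (b : ℝ) (x : Euc (m+1)) :
    ‖x + EuclideanSpace.single (Fin.last m) b‖^2 =
      (x (Fin.last m) + b)^2 + ‖(WithLp.toLp 2 (fun j : Fin m => x j.castSucc) : Euc m)‖^2 := by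
  rw [EuclideanSpace.real_norm_sq_eq, EuclideanSpace.real_norm_sq_eq, Fin.sum_univ_castSucc]
  simp [Fin.castSucc_ne_last]
  ring

def splitE (m : ℕ) : Euc (m+1) ≃ᵐ ℝ × Euc m :=
  ((MeasurableEquiv.toLp 2 (Fin (m+1) → ℝ)).symm.trans
    (MeasurableEquiv.piFinSuccAbove (fun _ => ℝ) (Fin.last m))).trans
    ((MeasurableEquiv.refl ℝ).prodCongr (MeasurableEquiv.toLp 2 (Fin m → ℝ)))

lemma splitE_apply (m : ℕ) (x : Euc (m+1)) :
    splitE m x = (x (Fin.last m), (WithLp.toLp 2 (fun j : Fin m => x j.castSucc) : Euc m)) := by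
  simp only [splitE, MeasurableEquiv.trans_apply]
  change (x (Fin.last m), (WithLp.toLp 2 (fun j : Fin m => x ((Fin.last m).succAbove j)) : Euc m)) = _
  simp

lemma splitE_mp (m : ℕ) : MeasurePreserving (splitE m) volume volume := by
  have h1 : MeasurePreserving (MeasurableEquiv.toLp 2 (Fin (m+1) → ℝ)).symm volume volume :=
    PiLp.volume_preserving_ofLp _
  have h2 := volume_preserving_piFinSuccAbove (fun _ : Fin (m+1) => ℝ) (Fin.last m)
  have h3 : MeasurePreserving (Prod.map id (MeasurableEquiv.toLp 2 (Fin m → ℝ))) (volume : Measure (ℝ × (Fin m → ℝ))) (volume : Measure (ℝ × Euc m)) :=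
    (MeasurePreserving.id volume).prod (PiLp.volume_preserving_toLp _)
  exact h3.comp (h2.comp h1)

lemma int_full (m p : ℕ) (hp : m + 1 < 2 * p) (ε b : ℝ) (hε : 0 < ε) :
    Integrable (fun x : Euc (m+1) => ((ε^2 + ‖x + EuclideanSpace.single (Fin.last m) b‖^2)^p)⁻¹) :=
  (int_pow (Euc (m+1)) p (by simpa using hp) (ε^2) (by positivity)).comp_add_right _

lemma fub (m p : ℕ) (hp : m + 1 < 2 * p) (ε b : ℝ) (hε : 0 < ε) :
    IntegrableOn (fun t : ℝ => ∫ y : Euc m, ((ε^2 + (t+b)^2 + ‖y‖^2)^p)⁻¹) (Set.Ioi 0) ∧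
    ∫ x in upperHS (m+1) (Nat.succ_pos m), ((ε^2 + ‖x + EuclideanSpace.single (Fin.last m) b‖^2)^p)⁻¹
      = ∫ t in Set.Ioi (0:ℝ), ∫ y : Euc m, ((ε^2 + (t+b)^2 + ‖y‖^2)^p)⁻¹ := by
  have hi := int_full m p hp ε b hε
  let g : ℝ × Euc m → ℝ := fun z => ((ε^2 + (z.1+b)^2 + ‖z.2‖^2)^p)⁻¹
  have e : (fun x : Euc (m+1) => ((ε^2 + ‖x + EuclideanSpace.single (Fin.last m) b‖^2)^p)⁻¹) = g ∘ splitE m := by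
    funext x
    simp only [g, Function.comp, splitE_apply, norm_emb, add_assoc]
  rw [e] at hi
  have hg : Integrable g (volume.prod volume) := ((splitE_mp m).integrable_comp_emb (splitE m).measurableEmbedding).1 hi
  have hs : upperHS (m+1) (Nat.succ_pos m) = splitE m ⁻¹' (Set.Ioi 0 ×ˢ Set.univ) := by
    ext x
    simp only [Set.mem_preimage, splitE_apply]
    simp [upperHS, lastIdx, Fin.last]
  refine ⟨hg.integral_prod_left.integrableOn, ?_⟩
  rw [hs]
  have h1 := (splitE_mp m).setIntegral_preimage_emb (splitE m).measurableEmbedding g (Set.Ioi 0 ×ˢ Set.univ)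
  have h2 := setIntegral_prod g (s := Set.Ioi (0:ℝ)) (t := Set.univ) hg.integrableOn
  simp only [Measure.restrict_univ] at h2
  calc _ = ∫ x in splitE m ⁻¹' (Set.Ioi 0 ×ˢ Set.univ), g (splitE m x) := by
        congr 1
    _ = _ := h1.trans h2

lemma ftc (m : ℕ) (hm : 2 ≤ m) (ε b J : ℝ) (hε : 0 < ε)
    (hi : IntegrableOn (fun t : ℝ => J * ((m-1) * ((√(ε^2 + (t+b)^2))^m)⁻¹ - m * ε^2 * ((√(ε^2 + (t+b)^2))^(m+2))⁻¹)) (Set.Ioi 0)) :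
    ∫ t in Set.Ioi (0:ℝ), J * ((m-1) * ((√(ε^2 + (t+b)^2))^m)⁻¹ - m * ε^2 * ((√(ε^2 + (t+b)^2))^(m+2))⁻¹)
      = J * b * ((√(ε^2 + b^2))^m)⁻¹ := by
  have d : ∀ t ∈ Set.Ici (0:ℝ), HasDerivAt (fun t : ℝ => - (J * ((t+b) * ((√(ε^2 + (t+b)^2))^m)⁻¹)))
      (J * ((m-1) * ((√(ε^2 + (t+b)^2))^m)⁻¹ - m * ε^2 * ((√(ε^2 + (t+b)^2))^(m+2))⁻¹)) t := by
    intro t _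
    have h0 : 0 < ε^2 + (t+b)^2 := by positivity
    have h1 : HasDerivAt (fun t : ℝ => t + b) 1 t := (hasDerivAt_id t).add_const b
    have h2 : HasDerivAt (fun t : ℝ => ε^2 + (t+b)^2) (2*(t+b)) t := by
      simpa using (h1.pow 2).const_add (ε^2)
    have h3 := ((h2.sqrt h0.ne').fun_pow m).fun_inv (by positivity)
    have h4 := ((h1.fun_mul h3).const_mul J).fun_neg
    refine h4.congr_deriv ?_
    obtain ⟨k, rfl⟩ : ∃ k, m = k+1 := ⟨m-1, by omega⟩
    have hA := Real.sq_sqrt h0.le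
    have hA0 := Real.sqrt_pos.2 h0
    set A := √(ε^2 + (t+b)^2)
    simp only [Nat.add_sub_cancel]
    have : ε^2 = A^2 - (t+b)^2 := by linarith
    rw [this]
    push_cast
    field_simp
    ring
  have t : Tendsto (fun t : ℝ => - (J * ((t+b) * ((√(ε^2 + (t+b)^2))^m)⁻¹))) atTop (𝓝 0) := by
    have : Tendsto (fun t : ℝ => (t+b) * ((√(ε^2 + (t+b)^2))^m)⁻¹) atTop (𝓝 0) := by
      refine tendsto_of_tendsto_of_tendsto_of_le_of_le' tendsto_const_nhds (tendsto_inv_atTop_zero.comp (tendsto_atTop_add_const_right atTop b tendsto_id)) ?_ ?_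
      · filter_upwards [eventually_gt_atTop (-b)] with r hr
        have : 0 < r + b := by linarith
        positivity
      · filter_upwards [eventually_ge_atTop (1-b)] with r hr
        have h1 : 1 ≤ r + b := by linarith
        have h2 : r + b ≤ √(ε^2 + (r+b)^2) := Real.le_sqrt_of_sq_le (by nlinarith)
        have h3 : (r+b)^2 ≤ (√(ε^2 + (r+b)^2))^m :=
          (pow_le_pow_right₀ h1 hm).trans (pow_le_pow_left₀ (by linarith) h2 m)
        calc (r+b) * ((√(ε^2 + (r+b)^2))^m)⁻¹ ≤ (r+b) * ((r+b)^2)⁻¹ := by gcongr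
          _ = _ := by simp only [Function.comp, id]; field_simp
    simpa using (this.const_mul J).neg
  rw [integral_Ioi_of_hasDerivAt_of_tendsto' d hi t]
  simp [mul_assoc]

lemma Ubub_eq (m : ℕ) (ε : ℝ) (x : Euc (m+1)) :
    Ubub (m+1) (Nat.succ_pos m) ε x = (ε * √(((m:ℝ)+1) * (m-1)) / (ε^2 + ‖x + EuclideanSpace.single (Fin.last m) (ε * xN0 (m+1))‖^2)) ^ (((m:ℝ)-1)/2) := by
  rw [Ubub, bubbleT, Ubub_def]
  push_cast
  rw [show (m:ℝ) + 1 - 2 = m - 1 by ring]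

lemma Ubub_pow1 (m : ℕ) (hm : 2 ≤ m) (ε : ℝ) (hε : 0 < ε) (x : Euc (m+1)) :
    Ubub (m+1) (Nat.succ_pos m) ε x ^ twoStar (m+1) = (ε * √(((m:ℝ)+1) * (m-1)))^(m+1) * ((ε^2 + ‖x + EuclideanSpace.single (Fin.last m) (ε * xN0 (m+1))‖^2)^(m+1))⁻¹ := by
  have hm' : (2:ℝ) ≤ m := by exact_mod_cast hm
  rw [Ubub_eq, ← Real.rpow_mul (by positivity), ← div_eq_mul_inv, ← div_pow, ← Real.rpow_natCast (_ / _) (m+1)]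
  congr 1
  rw [twoStar]
  push_cast
  have : (m:ℝ) - 1 ≠ 0 := by linarith
  rw [show (m:ℝ) + 1 - 2 = m - 1 by ring]
  field_simp

lemma Ubub_pow2 (m : ℕ) (hm : 2 ≤ m) (ε : ℝ) (hε : 0 < ε) (x : Euc (m+1)) :
    Ubub (m+1) (Nat.succ_pos m) ε x ^ twoStarL (m+1) = (ε * √(((m:ℝ)+1) * (m-1)))^m * ((ε^2 + ‖x + EuclideanSpace.single (Fin.last m) (ε * xN0 (m+1))‖^2)^m)⁻¹ := by
  have hm' : (2:ℝ) ≤ m := by exact_mod_cast hm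
  rw [Ubub_eq, ← Real.rpow_mul (by positivity), ← div_eq_mul_inv, ← div_pow, ← Real.rpow_natCast (_ / _) m]
  congr 1
  rw [twoStarL]
  push_cast
  have : (m:ℝ) - 1 ≠ 0 := by linarith
  rw [show (m:ℝ) + 1 - 2 = m - 1 by ring]
  field_simp
  ring

lemma Ubub_bdry (m : ℕ) (hm : 2 ≤ m) (ε : ℝ) (hε : 0 < ε) (y : Euc m) :
    Ubub (m+1) (Nat.succ_pos m) ε (emb (m+1) y) ^ twoStarL (m+1) = (ε * √(((m:ℝ)+1) * (m-1)))^m * (((√(ε^2 + (ε * xN0 (m+1))^2))^2 + ‖y‖^2)^m)⁻¹ := by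
  rw [Ubub_pow2 m hm ε hε, Real.sq_sqrt (by positivity), norm_emb]
  have h1 : (emb (m+1) y) (Fin.last m) = 0 := by simp [emb]
  have h2 : (WithLp.toLp 2 (fun j : Fin m => (emb (m+1) y) j.castSucc) : Euc m) = y := by
    ext j
    simp [emb]
  rw [h1, h2, zero_add, add_assoc]

lemma grad_eq (m : ℕ) (hm : 2 ≤ m) (ε : ℝ) (hε : 0 < ε) (x : Euc (m+1)) :
    gradSq (Ubub (m+1) (Nat.succ_pos m) ε) x = ((m:ℝ)-1)^2 * (ε * √(((m:ℝ)+1) * (m-1)))^(m-1) *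
      (((ε^2 + ‖x + EuclideanSpace.single (Fin.last m) (ε * xN0 (m+1))‖^2)^m)⁻¹ - ε^2 * ((ε^2 + ‖x + EuclideanSpace.single (Fin.last m) (ε * xN0 (m+1))‖^2)^(m+1))⁻¹) := by
  have hm' : (2:ℝ) ≤ m := by exact_mod_cast hm
  set v : Euc (m+1) := EuclideanSpace.single (Fin.last m) (ε * xN0 (m+1)) with hv
  have hc : 0 < ε * √(((m:ℝ)+1) * (m-1)) := by
    have : 0 < ((m:ℝ)+1) * (m-1) := by apply mul_pos <;> linarith
    positivity
  set C := ε * √(((m:ℝ)+1) * (m-1)) with hC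
  set q : ℝ := ((m:ℝ)-1)/2 with hq
  have hU : Ubub (m+1) (Nat.succ_pos m) ε = fun x => C^q * (ε^2 + ‖x + v‖^2)^(-q) := by
    funext x
    rw [Ubub_eq, Real.div_rpow hc.le (by positivity), Real.rpow_neg (by positivity), div_eq_mul_inv]
  have hD : 0 < ε^2 + ‖x+v‖^2 := by positivity
  have hd : ∀ i, pd (Ubub (m+1) (Nat.succ_pos m) ε) i x = C^q * (-q * (ε^2 + ‖x+v‖^2)^(-q-1)) * (2 * (x+v) i) := by
    intro i
    have h1 : HasFDerivAt (fun x : Euc (m+1) => ‖x+v‖^2) (2 • innerSL ℝ (x+v)) x := by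
      simpa using ((hasFDerivAt_id x).add_const v).norm_sq
    have h2 := ((h1.const_add (ε^2)).rpow_const (p := -q) (Or.inl hD.ne')).const_mul (C^q)
    rw [pd, hU, h2.fderiv]
    simp [EuclideanSpace.inner_single_right]
    ring
  rw [gradSq]
  simp only [hd, mul_pow]
  rw [← Finset.mul_sum, ← Finset.mul_sum, ← EuclideanSpace.real_norm_sq_eq]
  have e1 : (C^q)^2 = C^(m-1) := by
    rw [← Real.rpow_natCast, ← Real.rpow_mul hc.le, ← Real.rpow_natCast]
    congr 1
    rw [Nat.cast_sub (by omega), hq]; push_cast; ring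
  have e2 : ((ε^2 + ‖x+v‖^2)^(-q-1))^2 = ((ε^2 + ‖x+v‖^2)^(m+1))⁻¹ := by
    generalize ε^2 + ‖x+v‖^2 = D at *
    rw [← Real.rpow_natCast, ← Real.rpow_mul hD.le, ← Real.rpow_natCast _ (m+1), ← Real.rpow_neg hD.le]
    congr 1
    rw [hq]; push_cast; ring
  rw [e1, e2, hq]
  field_simp
  ring

open scoped Pointwise in
lemma smul_half (m : ℕ) (ε : ℝ) (hε : 0 < ε) : ε • upperHS (m+1) (Nat.succ_pos m) = upperHS (m+1) (Nat.succ_pos m) := by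
  ext x
  rw [Set.mem_smul_set_iff_inv_smul_mem₀ hε.ne']
  simp [upperHS, hε]

theorem main (m : ℕ) (hm : 2 ≤ m) :
    (∀ ε : ℝ, 0 < ε →
      IntegrableOn (fun x => gradSq (Ubub (m+1) (Nat.succ_pos m) ε) x) (upperHS (m+1) (Nat.succ_pos m)) ∧
      IntegrableOn (fun x => (Ubub (m+1) (Nat.succ_pos m) ε x) ^ twoStar (m+1)) (upperHS (m+1) (Nat.succ_pos m)) ∧
      Integrable (fun y : Euc m => (Ubub (m+1) (Nat.succ_pos m) ε (emb (m+1) y)) ^ twoStarL (m+1))) ∧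
    (∀ ε : ℝ, 0 < ε →
      ((∫ x in upperHS (m+1) (Nat.succ_pos m), gradSq (Ubub (m+1) (Nat.succ_pos m) ε) x)
          = ∫ x in upperHS (m+1) (Nat.succ_pos m), gradSq (Ubub (m+1) (Nat.succ_pos m) 1) x) ∧
      ((∫ x in upperHS (m+1) (Nat.succ_pos m), (Ubub (m+1) (Nat.succ_pos m) ε x) ^ twoStar (m+1))
          = ∫ x in upperHS (m+1) (Nat.succ_pos m), (Ubub (m+1) (Nat.succ_pos m) 1 x) ^ twoStar (m+1)) ∧
      ((∫ y : Euc m, (Ubub (m+1) (Nat.succ_pos m) ε (emb (m+1) y)) ^ twoStarL (m+1))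
          = ∫ y : Euc m, (Ubub (m+1) (Nat.succ_pos m) 1 (emb (m+1) y)) ^ twoStarL (m+1))) ∧
    (∀ ε : ℝ, 0 < ε →
      (∫ x in upperHS (m+1) (Nat.succ_pos m), gradSq (Ubub (m+1) (Nat.succ_pos m) ε) x)
        = (∫ x in upperHS (m+1) (Nat.succ_pos m), (Ubub (m+1) (Nat.succ_pos m) ε x) ^ twoStar (m+1))
          + ∫ y : Euc m, (Ubub (m+1) (Nat.succ_pos m) ε (emb (m+1) y)) ^ twoStarL (m+1)) := by
  have hm' : (2:ℝ) ≤ m := by exact_mod_cast hm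
  refine ⟨fun ε hε => ?_, fun ε hε => ?_, fun ε hε => ?_⟩
  · simp only [grad_eq m hm ε hε, Ubub_pow1 m hm ε hε, Ubub_bdry m hm ε hε]
    refine ⟨?_, ?_, ?_⟩
    · exact (((int_full m m (by omega) ε _ hε).sub ((int_full m (m+1) (by omega) ε _ hε).const_mul _)).const_mul _).integrableOn
    · exact ((int_full m (m+1) (by omega) ε _ hε).const_mul _).integrableOn
    · exact (int_pow (Euc m) m (by simp; omega) _ (by positivity)).const_mul _
  · have hs : ∀ x : Euc (m+1), ε^2 + ‖ε • x + EuclideanSpace.single (Fin.last m) (ε * xN0 (m+1))‖^2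
        = ε^2 * (1^2 + ‖x + EuclideanSpace.single (Fin.last m) (1 * xN0 (m+1))‖^2) := by
      intro x
      have : (EuclideanSpace.single (Fin.last m) (ε * xN0 (m+1)) : Euc (m+1)) = ε • EuclideanSpace.single (Fin.last m) (1 * xN0 (m+1)) := by
        ext j; by_cases h : j = Fin.last m <;> simp [h]
      rw [this, ← smul_add, norm_smul, Real.norm_of_nonneg hε.le]; ring
    have hint : ∀ f g : Euc (m+1) → ℝ, (∀ x, ε^(m+1) * f (ε • x) = g x) →
        ∫ x in upperHS (m+1) (Nat.succ_pos m), f x = ∫ x in upperHS (m+1) (Nat.succ_pos m), g x := by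
      intro f g h
      have := Measure.setIntegral_comp_smul_of_pos (volume : Measure (Euc (m+1))) f (upperHS (m+1) (Nat.succ_pos m)) hε
      rw [smul_half m ε hε, finrank_euclideanSpace_fin, smul_eq_mul] at this
      simp only [← h]
      rw [integral_const_mul, this]
      field_simp
    refine ⟨hint _ _ fun x => ?_, hint _ _ fun x => ?_, ?_⟩
    · rw [grad_eq m hm ε hε, grad_eq m hm 1 one_pos, hs]
      have : 0 < (1:ℝ)^2 + ‖x + EuclideanSpace.single (Fin.last m) (1 * xN0 (m+1))‖^2 := by positivity
      generalize (1:ℝ)^2 + ‖x + EuclideanSpace.single (Fin.last m) (1 * xN0 (m+1))‖^2 = D at *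
      generalize √(((m:ℝ)+1) * (m-1)) = c
      obtain ⟨k, rfl⟩ : ∃ k, m = k+1 := ⟨m-1, by omega⟩
      simp only [Nat.add_sub_cancel, mul_pow]
      field_simp
      ring
    · rw [Ubub_pow1 m hm ε hε, Ubub_pow1 m hm 1 one_pos, hs]
      have : 0 < (1:ℝ)^2 + ‖x + EuclideanSpace.single (Fin.last m) (1 * xN0 (m+1))‖^2 := by positivity
      generalize (1:ℝ)^2 + ‖x + EuclideanSpace.single (Fin.last m) (1 * xN0 (m+1))‖^2 = D at *
      generalize √(((m:ℝ)+1) * (m-1)) = c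
      simp only [mul_pow]
      field_simp
      ring
    · simp only [Ubub_bdry m hm ε hε, Ubub_bdry m hm 1 one_pos]
      rw [integral_const_mul, integral_const_mul, scale_int m m _ (by positivity) (by omega), scale_int m m √(1^2 + _) (by positivity) (by omega)]
      have : √(ε^2 + (ε * xN0 (m+1))^2) = ε * √(1^2 + (1 * xN0 (m+1))^2) := by
        rw [show ε^2 + (ε * xN0 (m+1))^2 = ε^2 * (1^2 + (1 * xN0 (m+1))^2) by ring, Real.sqrt_mul (by positivity), Real.sqrt_sq hε.le]
      rw [this, show 2 * m - m = m by omega]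
      have : 0 < √(1^2 + (1 * xN0 (m+1))^2) := by positivity
      simp only [mul_pow, one_pow]
      field_simp
  · simp only [grad_eq m hm ε hε, Ubub_pow1 m hm ε hε, Ubub_bdry m hm ε hε]
    rw [integral_const_mul, integral_const_mul, integral_const_mul, integral_sub (int_full m m (by omega) ε _ hε).integrableOn ((int_full m (m+1) (by omega) ε _ hε).const_mul _).integrableOn, integral_const_mul,
      scale_int m m _ (by positivity) (by omega)]
    obtain ⟨i1, f1⟩ := fub m m (by omega) ε (ε * xN0 (m+1)) hε
    obtain ⟨i2, f2⟩ := fub m (m+1) (by omega) ε (ε * xN0 (m+1)) hε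
    rw [f1, f2, show 2 * m - m = m by omega]
    have hb : (m-1) * (ε * xN0 (m+1)) = ε * √(((m:ℝ)+1) * (m-1)) := by
      have h1 : xN0 (m+1) = √(((m:ℝ)+1)/(m-1)) := by
        rw [xN0]; push_cast; rw [show (m:ℝ) + 1 - 2 = m - 1 by ring]
      have h2 : ((m:ℝ)+1) * (m-1) = (m-1)^2 * (((m:ℝ)+1)/(m-1)) := by
        have : (m:ℝ) - 1 ≠ 0 := by linarith
        field_simp
      rw [h2, Real.sqrt_mul (by positivity), Real.sqrt_sq (by linarith), h1]; ring
    have hc2 : (ε * √(((m:ℝ)+1) * (m-1)))^2 = ε^2 * (((m:ℝ)+1) * (m-1)) := by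
      rw [mul_pow, Real.sq_sqrt]
      apply mul_nonneg <;> linarith
    set b := ε * xN0 (m+1)
    set C := ε * √(((m:ℝ)+1) * (m-1))
    have s1 : ∀ t : ℝ, ∫ y : Euc m, ((ε^2 + (t+b)^2 + ‖y‖^2)^m)⁻¹ = ((√(ε^2 + (t+b)^2))^m)⁻¹ * ∫ y : Euc m, ((1 + ‖y‖^2)^m)⁻¹ := by
      intro t
      have := scale_int m m √(ε^2 + (t+b)^2) (by positivity) (by omega)
      rwa [Real.sq_sqrt (by positivity), show 2 * m - m = m by omega] at this
    have s2 : ∀ t : ℝ, ∫ y : Euc m, ((ε^2 + (t+b)^2 + ‖y‖^2)^(m+1))⁻¹ = ((√(ε^2 + (t+b)^2))^(m+2))⁻¹ * (1/2 * ∫ y : Euc m, ((1 + ‖y‖^2)^m)⁻¹) := by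
      intro t
      have := scale_int m (m+1) √(ε^2 + (t+b)^2) (by positivity) (by omega)
      rwa [Real.sq_sqrt (by positivity), show 2 * (m+1) - m = m+2 by omega, half_int m (by omega)] at this
    simp only [s1] at i1 ⊢
    simp only [s2] at i2 ⊢
    set J := ∫ y : Euc m, ((1 + ‖y‖^2)^m)⁻¹
    have hfun : (fun t : ℝ => J * ((m-1) * ((√(ε^2 + (t+b)^2))^m)⁻¹ - m * ε^2 * ((√(ε^2 + (t+b)^2))^(m+2))⁻¹)) = fun t => (m-1) * (((√(ε^2 + (t+b)^2))^m)⁻¹ * J) - (2*m*ε^2) * (((√(ε^2 + (t+b)^2))^(m+2))⁻¹ * (1/2*J)) := by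
      funext t; ring
    have hi := (i1.const_mul ((m:ℝ)-1)).sub (i2.const_mul (2*m*ε^2))
    have F := ftc m hm ε b J hε (by rw [hfun]; exact hi)
    rw [hfun, integral_sub (i1.const_mul ((m:ℝ)-1)) (i2.const_mul (2*m*ε^2)), integral_const_mul, integral_const_mul] at F
    have p1 : C^(m+1) = C^(m-1) * C^2 := by rw [← pow_add]; congr 1; omega
    have p2 : C^m = C^(m-1) * C := by rw [← pow_succ]; congr 1; omega
    rw [p1, p2, hc2]
    clear_value b C J
    linear_combination C^(m-1) * ((m:ℝ)-1) * F + C^(m-1) * (√(ε^2 + b^2)^m)⁻¹ * J * hb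


/-- the three energies `K₁(ε), K₂(ε), K₃(ε)` of the bubble `U_ε` are finite,
independent of `ε`, and satisfy `K₁ = K₂ + K₃`. -/
theorem statement10 (N : ℕ) (hN : 3 ≤ N) :
    (∀ ε : ℝ, 0 < ε →
      IntegrableOn (fun x => gradSq (Ubub N (by omega) ε) x) (upperHS N (by omega)) ∧
      IntegrableOn (fun x => (Ubub N (by omega) ε x) ^ twoStar N) (upperHS N (by omega)) ∧
      Integrable (fun y : Euc (N - 1) => (Ubub N (by omega) ε (emb N y)) ^ twoStarL N)) ∧
    (∀ ε ε' : ℝ, 0 < ε → 0 < ε' →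
      ((∫ x in upperHS N (by omega : 0 < N), gradSq (Ubub N (by omega) ε) x)
          = ∫ x in upperHS N (by omega : 0 < N), gradSq (Ubub N (by omega) ε') x) ∧
      ((∫ x in upperHS N (by omega : 0 < N), (Ubub N (by omega) ε x) ^ twoStar N)
          = ∫ x in upperHS N (by omega : 0 < N), (Ubub N (by omega) ε' x) ^ twoStar N) ∧
      ((∫ y : Euc (N - 1), (Ubub N (by omega) ε (emb N y)) ^ twoStarL N)
          = ∫ y : Euc (N - 1), (Ubub N (by omega) ε' (emb N y)) ^ twoStarL N)) ∧
    (∀ ε : ℝ, 0 < ε →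
      (∫ x in upperHS N (by omega : 0 < N), gradSq (Ubub N (by omega) ε) x)
        = (∫ x in upperHS N (by omega : 0 < N), (Ubub N (by omega) ε x) ^ twoStar N)
          + ∫ y : Euc (N - 1), (Ubub N (by omega) ε (emb N y)) ^ twoStarL N) := by

  obtain ⟨m, rfl⟩ : ∃ m, N = m+1 := ⟨N-1, by omega⟩
  obtain ⟨h1, h2, h3⟩ := main m (by omega)
  refine ⟨h1, fun ε ε' hε hε' => ?_, h3⟩
  obtain ⟨a1, a2, a3⟩ := h2 ε hε
  obtain ⟨b1, b2, b3⟩ := h2 ε' hε'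
  exact ⟨a1.trans b1.symm, a2.trans b2.symm, a3.trans b3.symm⟩
end
end

section
/- Let N ≥ 5. As ε → 0⁺, ∫_{ℝ^N_+} K(x)|∇Ũ_ε(x)|² dx = K₁ + α_N ε² + o(ε²), where α_N := ((N-2) k_N² / 2) ∫_{ℝ^N_+} (|y'|² + y_N (y_N + x_N⁰)) / (1 + |y'|² + (y_N + x_N⁰)²)^{N-1} dy. -/
open MeasureTheory Real Topology Filter

noncomputable section

/-- the shift direction `x_N⁰ e_N` -/
def aV (N : ℕ) (h : 0 < N) : Euc N := EuclideanSpace.single (lastIdx N h) (xN0 N)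

/-- gradient vector -/
def gV {N : ℕ} (φ : Euc N → ℝ) (x : Euc N) : Euc N := WithLp.toLp 2 (fun i => pd φ i x)

def QQ (N : ℕ) (h : 0 < N) (ε : ℝ) (x : Euc N) : ℝ := ε ^ 2 + ‖x + ε • aV N h‖ ^ 2

def DD (N : ℕ) (h : 0 < N) (y : Euc N) : ℝ := 1 + ‖y + aV N h‖ ^ 2

lemma Q_eq (N : ℕ) (h : 0 < N) (ε : ℝ) (x : Euc N) :
    ε ^ 2 + horizSq h x + (x (lastIdx N h) + ε * 1 * xN0 N) ^ 2 = QQ N h ε x := by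
  unfold QQ horizSq aV
  rw [EuclideanSpace.norm_sq_eq, ← Finset.sum_erase_add _ _ (Finset.mem_univ (lastIdx N h)), add_assoc]
  congr 2
  · apply Finset.sum_congr rfl
    intro i hi
    have : i ≠ lastIdx N h := (Finset.mem_erase.mp hi).1
    simp [this]
  · simp

lemma D_eq (N : ℕ) (h : 0 < N) (x : Euc N) :
    1 + horizSq h x + (x (lastIdx N h) + xN0 N) ^ 2 = DD N h x := by
  have := Q_eq N h 1 x
  simpa [QQ, DD] using this

lemma num_eq (N : ℕ) (h : 0 < N) (x : Euc N) :
    horizSq h x + x (lastIdx N h) * (x (lastIdx N h) + xN0 N) = inner ℝ x (x + aV N h) := by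
  unfold horizSq aV
  rw [PiLp.inner_apply, ← Finset.sum_erase_add _ _ (Finset.mem_univ (lastIdx N h))]
  congr 1
  · apply Finset.sum_congr rfl
    intro i hi
    have : i ≠ lastIdx N h := (Finset.mem_erase.mp hi).1
    simp [this, sq]
  · simp [mul_comm]

lemma xN0_nonneg (N : ℕ) : 0 ≤ xN0 N := Real.sqrt_nonneg _

lemma QQ_pos (N : ℕ) (h : 0 < N) {ε : ℝ} (hε : 0 < ε) (x : Euc N) : 0 < QQ N h ε x := by
  unfold QQ; positivity

lemma DD_pos (N : ℕ) (h : 0 < N) (x : Euc N) : 0 < DD N h x := by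
  unfold DD; positivity

lemma DD_ge (N : ℕ) (h : 0 < N) (x : Euc N) (hx : x ∈ upperHS N h) : 1 + ‖x‖ ^ 2 ≤ DD N h x := by
  have hx' : 0 < x (lastIdx N h) := hx
  unfold DD
  rw [norm_add_sq_real]
  have : inner ℝ x (aV N h) = x (lastIdx N h) * xN0 N := by
    unfold aV; simp [EuclideanSpace.inner_single_right, mul_comm]
  rw [this]
  have := mul_nonneg hx'.le (xN0_nonneg N)
  nlinarith [sq_nonneg ‖aV N h‖]

lemma QQ_smul (N : ℕ) (h : 0 < N) (ε : ℝ) (y : Euc N) :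
    QQ N h ε (ε • y) = ε ^ 2 * DD N h y := by
  unfold QQ DD
  rw [← smul_add, norm_smul, mul_pow, Real.norm_eq_abs, sq_abs]; ring

lemma kN_eq (N : ℕ) (hN : 5 ≤ N) :
    (Real.sqrt ((N : ℝ) * ((N : ℝ) - 2))) ^ (((N : ℝ) - 2) / 2) = kN N := by
  have h5 : (5 : ℝ) ≤ N := by exact_mod_cast hN
  have : (0 : ℝ) ≤ (N : ℝ) * ((N : ℝ) - 2) := mul_nonneg (by linarith) (by linarith)
  unfold kN
  rw [Real.sqrt_eq_rpow, ← Real.rpow_mul this]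
  congr 1; ring

lemma Ubub_eq_s13 (N : ℕ) (h : 0 < N) (hN : 5 ≤ N) {ε : ℝ} (hε : 0 < ε) (x : Euc N) :
    Ubub N h ε x = kN N * ε ^ (((N : ℝ) - 2) / 2) * (QQ N h ε x) ^ (-(((N : ℝ) - 2) / 2)) := by
  unfold Ubub bubbleT
  rw [Q_eq]
  have hQ := QQ_pos N h hε x
  rw [Real.div_rpow (by positivity) hQ.le, Real.mul_rpow hε.le (Real.sqrt_nonneg _), kN_eq N hN,
    Real.rpow_neg hQ.le]
  field_simp

lemma hasFDerivAt_Ubub (N : ℕ) (h : 0 < N) (hN : 5 ≤ N) {ε : ℝ} (hε : 0 < ε) (x : Euc N) :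
    HasFDerivAt (Ubub N h ε)
      ((-(((N : ℝ) - 2) * Ubub N h ε x / QQ N h ε x)) • innerSL ℝ (x + ε • aV N h)) x := by
  have hQ := QQ_pos N h hε x
  have h1 : HasFDerivAt (QQ N h ε) ((2 : ℝ) • innerSL ℝ (x + ε • aV N h)) x := by
    have h0 : HasFDerivAt (fun x : Euc N => x + ε • aV N h) (ContinuousLinearMap.id ℝ (Euc N)) x :=
      (hasFDerivAt_id x).add_const _
    have := (h0.norm_sq).const_add (ε ^ 2)
    refine this.congr_fderiv ?_
    ext v
    simp
  have h2 := (h1.rpow_const (p := -(((N : ℝ) - 2) / 2)) (Or.inl hQ.ne')).const_mul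
    (kN N * ε ^ (((N : ℝ) - 2) / 2))
  have h3 : Ubub N h ε = fun x => kN N * ε ^ (((N : ℝ) - 2) / 2) *
      (QQ N h ε x) ^ (-(((N : ℝ) - 2) / 2)) := funext (Ubub_eq_s13 N h hN hε)
  rw [h3]
  refine h2.congr_fderiv ?_
  rw [Real.rpow_sub_one hQ.ne']
  ext v
  simp
  field_simp

lemma Ubub_sq (N : ℕ) (h : 0 < N) (hN : 5 ≤ N) {ε : ℝ} (hε : 0 < ε) (x : Euc N) :
    (Ubub N h ε x) ^ 2 = kN N ^ 2 * ε ^ (N - 2) / (QQ N h ε x) ^ (N - 2) := by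
  have hQ := QQ_pos N h hε x
  have key : ∀ t : ℝ, 0 < t → (t ^ (((N : ℝ) - 2) / 2)) ^ 2 = t ^ (N - 2) := by
    intro t ht
    rw [← Real.rpow_natCast, ← Real.rpow_mul ht.le, ← Real.rpow_natCast]
    congr 1
    push_cast [Nat.cast_sub (show 2 ≤ N by omega)]
    ring
  rw [Ubub_eq_s13 N h hN hε, Real.rpow_neg hQ.le, mul_pow, mul_pow, inv_pow, key _ hε, key _ hQ]
  rfl

lemma gradSq_eq {N : ℕ} (u : Euc N → ℝ) (x v : Euc N) (hu : HasFDerivAt u (innerSL ℝ v) x) :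
    gradSq u x = ‖v‖ ^ 2 := by
  unfold gradSq pd
  rw [hu.fderiv, EuclideanSpace.norm_sq_eq]
  apply Finset.sum_congr rfl
  intro i _
  simp [EuclideanSpace.inner_single_right]

lemma hasFDerivAt_gV {N : ℕ} (φ : Euc N → ℝ) (hφ : Differentiable ℝ φ) (x : Euc N) :
    HasFDerivAt φ (innerSL ℝ (gV φ x)) x := by
  refine (hφ x).hasFDerivAt.congr_fderiv ?_
  apply ContinuousLinearMap.coe_injective
  refine (EuclideanSpace.basisFun (Fin N) ℝ).toBasis.ext ?_
  intro i
  simp [gV, pd, EuclideanSpace.inner_single_right]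

lemma Kw_gradSq (N : ℕ) (h : 0 < N) (hN : 5 ≤ N) {ε : ℝ} (hε : 0 < ε) (φ : Euc N → ℝ)
    (hφ : Differentiable ℝ φ) (x : Euc N) :
    Kw x * gradSq (Ut N h φ ε) x = kN N ^ 2 * ε ^ (N - 2) / (QQ N h ε x) ^ (N - 2) *
      ‖gV φ x - (((N : ℝ) - 2) * φ x / QQ N h ε x) • (x + ε • aV N h) - (φ x / 4) • x‖ ^ 2 := by
  have h0 : HasFDerivAt (fun x : Euc N => (Kw x) ^ (-(1 : ℝ) / 2))
      ((-(Kw x) ^ (-(1 : ℝ) / 2) / 4) • innerSL ℝ x) x := by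
    have h1 : (fun x : Euc N => (Kw x) ^ (-(1 : ℝ) / 2)) =
        fun x => Real.exp (‖x‖ ^ 2 * (-1 / 8)) := by
      funext z
      unfold Kw
      rw [← Real.exp_mul]; congr 1; ring
    have h2 := (((hasFDerivAt_id x).norm_sq).mul_const (-1 / 8 : ℝ)).exp
    have h3 := congrFun h1 x
    rw [h1, h3]
    refine h2.congr_fderiv ?_
    ext v
    simp
    ring
  have h1 := (h0.mul (hasFDerivAt_gV φ hφ x)).mul (hasFDerivAt_Ubub N h hN hε x)
  have h2 : HasFDerivAt (Ut N h φ ε) (innerSL ℝ (((Kw x) ^ (-(1 : ℝ) / 2) * Ubub N h ε x) •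
      (gV φ x - (((N : ℝ) - 2) * φ x / QQ N h ε x) • (x + ε • aV N h) - (φ x / 4) • x))) x := by
    refine h1.congr_fderiv ?_
    ext v
    simp
    ring
  rw [gradSq_eq _ _ _ h2, norm_smul, mul_pow, Real.norm_eq_abs, sq_abs, mul_pow, Ubub_sq N h hN hε]
  have h3 : Kw x * ((Kw x) ^ (-(1 : ℝ) / 2)) ^ 2 = 1 := by
    unfold Kw
    rw [← Real.exp_mul, ← Real.exp_nat_mul, ← Real.exp_add, Real.exp_eq_one_iff]
    push_cast; ring
  linear_combination (kN N ^ 2 * ε ^ (N - 2) / (QQ N h ε x) ^ (N - 2) *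
      ‖gV φ x - (((N : ℝ) - 2) * φ x / QQ N h ε x) • (x + ε • aV N h) - (φ x / 4) • x‖ ^ 2) * h3

lemma Kone_int (N : ℕ) (h : 0 < N) (hN : 5 ≤ N) (x : Euc N) :
    gradSq (Ubub N h 1) x = kN N ^ 2 / (DD N h x) ^ (N - 2) *
      (((N : ℝ) - 2) ^ 2 * ‖x + aV N h‖ ^ 2 / DD N h x ^ 2) := by
  have h1 := hasFDerivAt_Ubub N h hN one_pos x
  have h2 : HasFDerivAt (Ubub N h 1) (innerSL ℝ
      ((-(((N : ℝ) - 2) * Ubub N h 1 x / QQ N h 1 x)) • (x + (1 : ℝ) • aV N h))) x := by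
    refine h1.congr_fderiv ?_
    ext v
    simp
  rw [gradSq_eq _ _ _ h2, norm_smul, mul_pow, Real.norm_eq_abs, sq_abs]
  have h3 : QQ N h 1 x = DD N h x := by simp [QQ, DD]
  have h4 := Ubub_sq N h hN one_pos x
  rw [h3] at *
  rw [neg_sq, div_pow, mul_pow, h4, one_smul, one_pow]
  ring

/-- the rescaled integrand (divided by `ε²`) -/
def FF (N : ℕ) (h : 0 < N) (φ : Euc N → ℝ) (ε : ℝ) (y : Euc N) : ℝ :=
  kN N ^ 2 / (DD N h y) ^ (N - 2) *
    ‖gV φ (ε • y) - (((N : ℝ) - 2) * φ (ε • y) / (ε * DD N h y)) • (y + aV N h)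
      - (ε * φ (ε • y) / 4) • y‖ ^ 2

def HH (N : ℕ) (h : 0 < N) (y : Euc N) : ℝ :=
  kN N ^ 2 / (DD N h y) ^ (N - 2) * (((N : ℝ) - 2) ^ 2 * ‖y + aV N h‖ ^ 2 / DD N h y ^ 2)

lemma scaled (N : ℕ) (h : 0 < N) (hN : 5 ≤ N) {ε : ℝ} (hε : 0 < ε) (φ : Euc N → ℝ)
    (hφ : Differentiable ℝ φ) (y : Euc N) :
    ε ^ N * (Kw (ε • y) * gradSq (Ut N h φ ε) (ε • y)) = ε ^ 2 * FF N h φ ε y := by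
  rw [Kw_gradSq N h hN hε φ hφ, QQ_smul]
  unfold FF
  have hD := DD_pos N h y
  have e1 : (((N : ℝ) - 2) * φ (ε • y) / (ε ^ 2 * DD N h y)) • (ε • y + ε • aV N h)
      = (((N : ℝ) - 2) * φ (ε • y) / (ε * DD N h y)) • (y + aV N h) := by
    rw [← smul_add, smul_smul]; congr 1; field_simp
  have e2 : (φ (ε • y) / 4) • ε • y = (ε * φ (ε • y) / 4) • y := by
    rw [smul_smul]; congr 1; ring
  rw [e1, e2]
  have e3 : ε ^ N = ε ^ (N - 2) * ε ^ 2 := by rw [← pow_add]; congr 1; omega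
  rw [e3, mul_pow, ← pow_mul, mul_comm 2, pow_mul]
  have : ε ^ (N - 2) ≠ 0 := by positivity
  field_simp

open scoped Pointwise in
lemma change_var (N : ℕ) (h : 0 < N) {ε : ℝ} (hε : 0 < ε) (f : Euc N → ℝ) :
    ∫ x in upperHS N h, f x = ε ^ N * ∫ y in upperHS N h, f (ε • y) := by
  have hs : ε • upperHS N h = upperHS N h := by
    ext x
    rw [Set.mem_smul_set_iff_inv_smul_mem₀ hε.ne']
    simp [upperHS, hε]
  have := Measure.setIntegral_comp_smul_of_pos (volume : Measure (Euc N)) f (upperHS N h) hε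
  rw [hs] at this
  rw [this]
  have : ε ^ N ≠ 0 := by positivity
  simp
  field_simp

/-- expansion of the difference quotient -/
def GG (N : ℕ) (h : 0 < N) (φ : Euc N → ℝ) (ε : ℝ) (y : Euc N) : ℝ :=
  FF N h φ ε y - HH N h y / ε ^ 2

lemma GG_eq (N : ℕ) (h : 0 < N) {ε : ℝ} (hε : 0 < ε) (φ : Euc N → ℝ) (y : Euc N) :
    GG N h φ ε y = kN N ^ 2 / (DD N h y) ^ (N - 2) *
      (‖gV φ (ε • y) - (ε * φ (ε • y) / 4) • y‖ ^ 2
       - 2 * ((N : ℝ) - 2) * φ (ε • y) * (inner ℝ (gV φ (ε • y) - (ε * φ (ε • y) / 4) • y)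
          (y + aV N h) / (ε * DD N h y))
       + (φ (ε • y) ^ 2 - 1) / ε ^ 2 * (((N : ℝ) - 2) ^ 2 * ‖y + aV N h‖ ^ 2 / DD N h y ^ 2)) := by
  unfold GG FF HH
  have hD := DD_pos N h y
  rw [sub_right_comm, norm_sub_sq_real, inner_smul_right, norm_smul, mul_pow, Real.norm_eq_abs,
    sq_abs]
  field_simp
  ring

lemma gV_small {N : ℕ} (φ : Euc N → ℝ) (hφ : IsCutoff N φ) (x : Euc N) (hx : ‖x‖ < 1) :
    gV φ x = 0 := by
  have : φ =ᶠ[𝓝 x] fun _ => 1 := by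
    filter_upwards [Metric.isOpen_ball.mem_nhds (show x ∈ Metric.ball (0 : Euc N) 1 by simpa using hx)]
      with z hz
    exact hφ.eq_one z (Metric.ball_subset_closedBall hz)
  ext i
  simp [gV, pd, this.fderiv_eq]

lemma gV_big {N : ℕ} (φ : Euc N → ℝ) (hφ : IsCutoff N φ) (x : Euc N) (hx : 2 < ‖x‖) :
    gV φ x = 0 := by
  have : φ =ᶠ[𝓝 x] fun _ => 0 := by
    filter_upwards [(isOpen_lt continuous_const continuous_norm).mem_nhds hx] with z hz
    refine hφ.eq_zero z ?_
    have hz' : 2 < ‖z‖ := hz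
    simp [hz'.le]
  ext i
  simp [gV, pd, this.fderiv_eq]

lemma gV_cont {N : ℕ} (φ : Euc N → ℝ) (hφ : IsCutoff N φ) : Continuous (gV φ) := by
  have h1 : Continuous (fderiv ℝ φ) := hφ.smooth.continuous_fderiv (by simp)
  unfold gV pd
  fun_prop

lemma gV_bdd {N : ℕ} (φ : Euc N → ℝ) (hφ : IsCutoff N φ) :
    ∃ M, 0 ≤ M ∧ ∀ x, ‖gV φ x‖ ≤ M ∧ ‖gV φ x‖ ≤ M * ‖x‖ := by
  obtain ⟨M, hM⟩ := (isCompact_closedBall (0 : Euc N) 2).exists_bound_of_continuousOn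
    (gV_cont φ hφ).continuousOn
  have hM0 : 0 ≤ M := (norm_nonneg _).trans (hM 0 (by simp))
  refine ⟨M, hM0, fun x => ?_⟩
  rcases lt_or_ge ‖x‖ 1 with h1 | h1
  · rw [gV_small φ hφ x h1]; simp; exact ⟨hM0, by positivity⟩
  rcases lt_or_ge 2 ‖x‖ with h2 | h2
  · rw [gV_big φ hφ x h2]; simp; exact ⟨hM0, by positivity⟩
  have := hM x (by simpa using h2)
  exact ⟨this, by nlinarith⟩

lemma GG_bound (N : ℕ) (h : 0 < N) (hN : 5 ≤ N) (φ : Euc N → ℝ) (hφ : IsCutoff N φ) :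
    ∃ C, 0 ≤ C ∧ ∀ ε > 0, ∀ y ∈ upperHS N h, |GG N h φ ε y| ≤ kN N ^ 2 / (DD N h y) ^ (N - 2) * C := by
  obtain ⟨M, hM0, hM⟩ := gV_bdd φ hφ
  have h5 : (5 : ℝ) ≤ N := by exact_mod_cast hN
  have hn : (0 : ℝ) ≤ (N : ℝ) - 2 := by linarith
  refine ⟨(M + 1) ^ 2 + 2 * ((N : ℝ) - 2) * (M + 1) + ((N : ℝ) - 2) ^ 2, by positivity, ?_⟩
  intro ε hε y hy
  rw [GG_eq N h hε]
  have hD := DD_pos N h y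
  have hDy := DD_ge N h y hy
  have hDp : ‖y + aV N h‖ ^ 2 ≤ DD N h y := by unfold DD; linarith
  have hpy : ‖y‖ * ‖y + aV N h‖ ≤ DD N h y := by
    nlinarith [sq_nonneg (‖y‖ - ‖y + aV N h‖)]
  have hnx : ‖ε • y‖ = ε * ‖y‖ := by rw [norm_smul, Real.norm_eq_abs, abs_of_pos hε]
  obtain ⟨p0, p1⟩ := hφ.mem01 (ε • y)
  obtain ⟨g1, g2⟩ := hM (ε • y)
  rw [hnx] at g2
  set f := φ (ε • y) with hf
  set p := y + aV N h
  have w0 : ‖(ε * f / 4) • y‖ = f * (ε * ‖y‖) / 4 := by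
    rw [norm_smul, Real.norm_eq_abs, abs_of_nonneg (by positivity)]; ring
  have w1 : f * (ε * ‖y‖) ≤ 2 := by
    rcases lt_or_ge (ε * ‖y‖) 2 with h1 | h1
    · have : 0 ≤ ε * ‖y‖ := by positivity
      nlinarith
    · have : f = 0 := hφ.eq_zero _ (by simp only [Metric.mem_ball, dist_zero_right, hnx]; linarith)
      rw [this]; norm_num
  have w2 : f * (ε * ‖y‖) ≤ ε * ‖y‖ := by
    have : 0 ≤ ε * ‖y‖ := by positivity
    nlinarith
  set w := gV φ (ε • y) - (ε * f / 4) • y with hw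
  have wle := norm_sub_le (gV φ (ε • y)) ((ε * f / 4) • y)
  rw [← hw, w0] at wle
  have b1 : ‖w‖ ≤ M + 1 := by linarith
  have b2 : ‖w‖ ≤ (M + 1) * (ε * ‖y‖) := by
    have : 0 ≤ ε * ‖y‖ := by positivity
    linarith
  have c2 : |inner ℝ w p / (ε * DD N h y)| ≤ M + 1 := by
    rw [abs_div, abs_of_pos (by positivity : 0 < ε * DD N h y), div_le_iff₀ (by positivity)]
    calc |inner ℝ w p| ≤ ‖w‖ * ‖p‖ := abs_real_inner_le_norm _ _
      _ ≤ (M + 1) * (ε * ‖y‖) * ‖p‖ := by gcongr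
      _ = (M + 1) * ε * (‖y‖ * ‖p‖) := by ring
      _ ≤ (M + 1) * ε * DD N h y := by gcongr
      _ = _ := by ring
  have d1 : |f ^ 2 - 1| ≤ (ε * ‖y‖) ^ 2 := by
    rcases le_or_gt (ε * ‖y‖) 1 with h1 | h1
    · have : f = 1 := hφ.eq_one _ (by simp only [Metric.mem_closedBall, dist_zero_right, hnx]; exact h1)
      rw [this]; simp; positivity
    · rw [abs_le]; constructor <;> nlinarith
  have c3 : |(f ^ 2 - 1) / ε ^ 2 * (((N : ℝ) - 2) ^ 2 * ‖p‖ ^ 2 / DD N h y ^ 2)|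
      ≤ ((N : ℝ) - 2) ^ 2 := by
    rw [abs_mul, abs_div, abs_of_pos (by positivity : 0 < ε ^ 2),
      abs_of_nonneg (by positivity : 0 ≤ ((N : ℝ) - 2) ^ 2 * ‖p‖ ^ 2 / DD N h y ^ 2)]
    calc _ ≤ (ε * ‖y‖) ^ 2 / ε ^ 2 * (((N : ℝ) - 2) ^ 2 * ‖p‖ ^ 2 / DD N h y ^ 2) := by gcongr
      _ = ((N : ℝ) - 2) ^ 2 * ((‖y‖ * ‖p‖) ^ 2 / DD N h y ^ 2) := by field_simp
      _ ≤ ((N : ℝ) - 2) ^ 2 * 1 := by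
        gcongr
        rw [div_le_one (by positivity)]
        gcongr
      _ = _ := mul_one _
  rw [abs_mul, abs_of_nonneg (by positivity : 0 ≤ kN N ^ 2 / (DD N h y) ^ (N - 2))]
  gcongr
  refine (abs_add_le _ _).trans (add_le_add ((abs_sub _ _).trans (add_le_add ?_ ?_)) c3)
  · rw [abs_of_nonneg (by positivity)]; gcongr
  · rw [abs_mul, abs_of_nonneg (by positivity : 0 ≤ 2 * ((N : ℝ) - 2) * f)]
    calc _ ≤ 2 * ((N : ℝ) - 2) * 1 * (M + 1) := by gcongr
      _ = _ := by ring

lemma DD_cont (N : ℕ) (h : 0 < N) : Continuous (DD N h) := by unfold DD; fun_prop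

lemma base_int (N : ℕ) (h : 0 < N) (hN : 5 ≤ N) (C : ℝ) :
    IntegrableOn (fun y => kN N ^ 2 / (DD N h y) ^ (N - 2) * C) (upperHS N h) := by
  have hfin : (Module.finrank ℝ (Euc N) : ℝ) < 2 * ((N : ℝ) - 2) := by
    have h5 : (5 : ℝ) ≤ N := by exact_mod_cast hN
    simp; linarith
  have h1 := (integrable_rpow_neg_one_add_norm_sq (μ := (volume : Measure (Euc N))) hfin).integrableOn
    (s := upperHS N h)
  have hm : MeasurableSet (upperHS N h) :=
    (isOpen_lt continuous_const (by fun_prop)).measurableSet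
  apply Integrable.mul_const
  have hc : Continuous fun y => kN N ^ 2 / (DD N h y) ^ (N - 2) :=
    continuous_const.div ((DD_cont N h).pow _) (fun y => (pow_pos (DD_pos N h y) _).ne')
  refine (h1.const_mul (kN N ^ 2)).mono' hc.aestronglyMeasurable ?_
  rw [ae_restrict_iff' hm]
  refine Eventually.of_forall fun y hy => ?_
  have hD := DD_pos N h y
  rw [Real.norm_eq_abs, abs_of_nonneg (by positivity), div_eq_mul_inv]
  gcongr
  have e : ((1 : ℝ) + ‖y‖ ^ 2) ^ (-(2 * ((N : ℝ) - 2)) / 2) = ((1 + ‖y‖ ^ 2) ^ (N - 2))⁻¹ := by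
    rw [← Real.rpow_natCast (1 + ‖y‖ ^ 2), ← Real.rpow_neg (by positivity)]
    congr 1
    push_cast [Nat.cast_sub (show 2 ≤ N by omega)]
    ring
  rw [e]
  have := DD_ge N h y hy
  gcongr

lemma HH_cont (N : ℕ) (h : 0 < N) : Continuous (HH N h) := by
  have := DD_cont N h
  have h2 := fun y => (DD_pos N h y).ne'
  unfold HH
  fun_prop (disch := intro x; first | exact h2 x | exact pow_ne_zero _ (h2 x))

lemma FF_cont (N : ℕ) (h : 0 < N) (φ : Euc N → ℝ) (hφ : IsCutoff N φ) {ε : ℝ} (hε : 0 < ε) :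
    Continuous (FF N h φ ε) := by
  have := DD_cont N h
  have h2 := fun y => (DD_pos N h y).ne'
  have h3 := gV_cont φ hφ
  have h4 := hφ.smooth.continuous
  unfold FF
  fun_prop (disch := intro x; first | exact pow_ne_zero _ (h2 x) | exact mul_ne_zero hε.ne' (h2 x))

lemma HH_int (N : ℕ) (h : 0 < N) (hN : 5 ≤ N) : IntegrableOn (HH N h) (upperHS N h) := by
  refine (base_int N h hN (((N : ℝ) - 2) ^ 2)).mono' (HH_cont N h).aestronglyMeasurable ?_
  refine Eventually.of_forall fun y => ?_
  have hD := DD_pos N h y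
  unfold HH
  rw [Real.norm_eq_abs, abs_of_nonneg (by positivity), mul_div_assoc]
  have hDp : ‖y + aV N h‖ ^ 2 ≤ DD N h y := by unfold DD; linarith
  have hD1 : 1 ≤ DD N h y := by unfold DD; nlinarith [sq_nonneg ‖y + aV N h‖]
  have : ‖y + aV N h‖ ^ 2 / DD N h y ^ 2 ≤ 1 := by
    rw [div_le_one (by positivity)]; nlinarith
  gcongr
  nlinarith [sq_nonneg ((N : ℝ) - 2)]

/-- Lemma 3.1, `N ≥ 5`: `∫ K|∇Ũ_ε|² = K₁ + α_N ε² + o(ε²)` as `ε → 0⁺`. -/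
theorem statement13 (N : ℕ) (hN : 5 ≤ N) (φ : Euc N → ℝ) (hφ : IsCutoff N φ) :
    Tendsto (fun ε : ℝ =>
        ((∫ x in upperHS N (by omega : 0 < N), Kw x * gradSq (Ut N (by omega) φ ε) x)
            - Kone N (by omega)
            - ((((N : ℝ) - 2) * (kN N) ^ 2 / 2) *
                ∫ y in upperHS N (by omega : 0 < N),
                  (horizSq (by omega) y
                      + y (lastIdx N (by omega)) * (y (lastIdx N (by omega)) + xN0 N)) /
                    (1 + horizSq (by omega) y
                      + (y (lastIdx N (by omega)) + xN0 N) ^ 2) ^ (N - 1)) * ε ^ 2)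
          / ε ^ 2)
      (𝓝[>] (0 : ℝ)) (𝓝 0) := by
  have h : 0 < N := by omega
  have hdiff : Differentiable ℝ φ := hφ.smooth.differentiable (by simp)
  have hm : MeasurableSet (upperHS N h) :=
    (isOpen_lt continuous_const (by fun_prop)).measurableSet
  obtain ⟨C, hC0, hC⟩ := GG_bound N h hN φ hφ
  have hK : Kone N h = ∫ y in upperHS N h, HH N h y := by
    unfold Kone
    simp only [Kone_int N h hN]
    rfl
  have hGm : ∀ ε > 0, AEStronglyMeasurable (GG N h φ ε) (volume.restrict (upperHS N h)) := by
    intro ε hε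
    exact ((FF_cont N h φ hφ hε).sub ((HH_cont N h).div_const _)).aestronglyMeasurable
  have hGb : ∀ ε > 0, ∀ᵐ y ∂(volume.restrict (upperHS N h)),
      ‖GG N h φ ε y‖ ≤ kN N ^ 2 / (DD N h y) ^ (N - 2) * C := by
    intro ε hε
    rw [ae_restrict_iff' hm]
    exact Eventually.of_forall fun y hy => hC ε hε y hy
  have hGi : ∀ ε > 0, IntegrableOn (GG N h φ ε) (upperHS N h) := fun ε hε =>
    (base_int N h hN C).mono' (hGm ε hε) (hGb ε hε)
  set L : Euc N → ℝ := fun y => (((N : ℝ) - 2) * (kN N) ^ 2 / 2) *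
    (inner ℝ y (y + aV N h) / (DD N h y) ^ (N - 1)) with hL
  have hlim : Tendsto (fun ε => ∫ y in upperHS N h, GG N h φ ε y) (𝓝[>] 0)
      (𝓝 (∫ y in upperHS N h, L y)) := by
    refine tendsto_integral_filter_of_dominated_convergence
      (fun y => kN N ^ 2 / (DD N h y) ^ (N - 2) * C) ?_ ?_ (base_int N h hN C) ?_
    · filter_upwards [self_mem_nhdsWithin] with ε hε using hGm ε hε
    · filter_upwards [self_mem_nhdsWithin] with ε hε using hGb ε hε
    · refine Eventually.of_forall fun y => ?_
      have hD := DD_pos N h y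
      have ht : Tendsto (fun ε : ℝ => kN N ^ 2 / (DD N h y) ^ (N - 2) *
          (ε ^ 2 / 16 * ‖y‖ ^ 2) + L y) (𝓝[>] 0) (𝓝 (L y)) := by
        have hc : Continuous (fun ε : ℝ => kN N ^ 2 / (DD N h y) ^ (N - 2) *
          (ε ^ 2 / 16 * ‖y‖ ^ 2) + L y) := by fun_prop
        have := hc.tendsto 0
        simp only [ne_eq, OfNat.ofNat_ne_zero, not_false_eq_true, zero_pow, zero_div, zero_mul,
          mul_zero, zero_add] at this
        exact this.mono_left nhdsWithin_le_nhds
      refine ht.congr' ?_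
      have hsm : ∀ᶠ ε : ℝ in 𝓝[>] 0, ‖ε • y‖ < 1 := by
        have hc : Continuous (fun ε : ℝ => ‖ε • y‖) := by fun_prop
        have := hc.tendsto 0
        simp only [zero_smul, norm_zero] at this
        exact (this.mono_left nhdsWithin_le_nhds).eventually_lt_const one_pos
      filter_upwards [hsm, self_mem_nhdsWithin] with ε h1 hε
      have hε' : 0 < ε := hε
      rw [GG_eq N h hε', gV_small φ hφ _ h1, hφ.eq_one (ε • y) (by simpa using h1.le), hL]
      have e : DD N h y ^ (N - 1) = DD N h y ^ (N - 2) * DD N h y := by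
        rw [← pow_succ]; congr 1; omega
      simp only [e, zero_sub, norm_neg, inner_neg_left, inner_smul_left, norm_smul, mul_pow,
        Real.norm_eq_abs, sq_abs, conj_trivial]
      field_simp
      ring
  have hα : ∀ α : ℝ, α = ∫ y in upperHS N h, L y →
      Tendsto (fun ε : ℝ => ((∫ x in upperHS N h, Kw x * gradSq (Ut N h φ ε) x) - Kone N h
        - α * ε ^ 2) / ε ^ 2) (𝓝[>] (0 : ℝ)) (𝓝 0) := by
    intro α hα
    have h0 : Tendsto (fun ε => (∫ y in upperHS N h, GG N h φ ε y) - α) (𝓝[>] 0) (𝓝 0) := by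
      simpa [hα] using hlim.sub_const α
    refine h0.congr' ?_
    filter_upwards [self_mem_nhdsWithin] with ε hε
    have hε' : 0 < ε := hε
    have hF : FF N h φ ε = fun y => GG N h φ ε y + HH N h y / ε ^ 2 := by
      funext y; unfold GG; ring
    have h2 : ∫ x in upperHS N h, Kw x * gradSq (Ut N h φ ε) x
        = ε ^ 2 * ((∫ y in upperHS N h, GG N h φ ε y) + (∫ y in upperHS N h, HH N h y) / ε ^ 2) := by
      rw [change_var N h hε', ← integral_const_mul]
      simp only [scaled N h hN hε' φ hdiff]
      rw [integral_const_mul, hF, integral_add (hGi ε hε') ((HH_int N h hN).div_const _),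
        integral_div]
    rw [h2, hK]
    field_simp
    ring
  refine hα _ ?_
  rw [hL, integral_const_mul]
  simp only [D_eq, num_eq]
end
end
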